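/- arXiv:2410.09590 — 3 statements merged into one kernel-verified Lean document; each statement's English description precedes it below -/
import Mathlib

section
/- Fix n ≥ 1, M ∈ SO(n), and κ ∈ [0, 1), and set γ = (1+κ)/(1−κ). Let μ be the Haar probability measure on the compact group SO(n), and define T : SO(n) → SO(n) on the μ-full-measure set of P with I + P invertible by T(P) = C( γ⁻¹ · (P − I)(I + P)⁻¹ ) · M, where C is the Cayley transform. Then for every bounded measurable g : SO(n) → ℝ, ∫ g(T(P)) dμ(P) = ∫ g(P) · (1 − κ²)^{n(n−1)/2} · det(P Mᵀ − κI)^{−(n−1)} dμ(P); equivalently, the pushforward of μ under T equals μ weighted by the density f_n(P; M, κ) = (1 − κ²)^{n(n−1)/2} det(P Mᵀ − κI)^{−(n−1)}. -/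
open Matrix MeasureTheory

noncomputable instance {n : ℕ} : MeasurableSpace (Matrix (Fin n) (Fin n) ℝ) := borel _
instance {n : ℕ} : BorelSpace (Matrix (Fin n) (Fin n) ℝ) := ⟨rfl⟩

/-- The Cayley transform `C(A) = (I - A)⁻¹ (I + A)`. -/
noncomputable def cayley {n : ℕ} (A : Matrix (Fin n) (Fin n) ℝ) :
    Matrix (Fin n) (Fin n) ℝ :=
  (1 - A)⁻¹ * (1 + A)

/-- The inverse Cayley transform `P ↦ (P - I) (I + P)⁻¹`. -/
noncomputable def invCayley {n : ℕ} (P : Matrix (Fin n) (Fin n) ℝ) :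
    Matrix (Fin n) (Fin n) ℝ :=
  (P - 1) * (1 + P)⁻¹

/-! ### Skew-symmetric matrices in coordinates -/

/-- Strictly upper triangular coordinates on the skew-symmetric matrices. -/
abbrev SkewCoord (n : ℕ) : Type := {p : Fin n × Fin n // p.1 < p.2} → ℝ

/-- The skew-symmetric matrix with given strictly upper triangular entries. -/
def toSkew {n : ℕ} : SkewCoord n →ₗ[ℝ] Matrix (Fin n) (Fin n) ℝ where
  toFun x := Matrix.of fun i j =>
    if h : i < j then x ⟨(i, j), h⟩ else if h : j < i then -x ⟨(j, i), h⟩ else 0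
  map_add' x y := by
    ext i j
    simp only [of_apply, Matrix.add_apply, Pi.add_apply]
    split_ifs <;> ring
  map_smul' c x := by
    ext i j
    simp only [of_apply, Matrix.smul_apply, Pi.smul_apply, smul_eq_mul, RingHom.id_apply]
    split_ifs <;> ring

/-- The strictly upper triangular entries of a matrix. -/
def ofSkew {n : ℕ} : Matrix (Fin n) (Fin n) ℝ →ₗ[ℝ] SkewCoord n where
  toFun X p := X p.1.1 p.1.2
  map_add' _ _ := rfl
  map_smul' _ _ := rfl

lemma toSkew_apply {n : ℕ} (x : SkewCoord n) (i j : Fin n) :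
    toSkew x i j =
      if h : i < j then x ⟨(i, j), h⟩ else if h : j < i then -x ⟨(j, i), h⟩ else 0 := rfl

lemma ofSkew_apply {n : ℕ} (X : Matrix (Fin n) (Fin n) ℝ) (p : {p : Fin n × Fin n // p.1 < p.2}) :
    ofSkew X p = X p.1.1 p.1.2 := rfl

lemma ofSkew_toSkew {n : ℕ} (x : SkewCoord n) : ofSkew (toSkew x) = x := by
  ext p
  simp [ofSkew_apply, toSkew_apply, p.2]

lemma transpose_toSkew {n : ℕ} (x : SkewCoord n) : (toSkew x)ᵀ = -toSkew x := by
  ext i j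
  simp only [transpose_apply, Matrix.neg_apply, toSkew_apply]
  rcases lt_trichotomy i j with h | h | h
  · simp [h, h.not_gt]
  · simp [h]
  · simp [h, h.not_gt]

lemma toSkew_ofSkew {n : ℕ} {X : Matrix (Fin n) (Fin n) ℝ} (hX : Xᵀ = -X) :
    toSkew (ofSkew X) = X := by
  have hX' : ∀ i j, X j i = -X i j := fun i j => by
    simpa using congrFun (congrFun hX i) j
  ext i j
  rcases lt_trichotomy i j with h | h | h
  · simp [toSkew_apply, ofSkew_apply, h]
  · subst h
    have := hX' i i
    simp only [toSkew_apply, lt_irrefl, dite_false]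
    linarith
  · simp [toSkew_apply, ofSkew_apply, h, h.not_gt, hX' j i]

/-- The congruence `X ↦ N X Nᵀ` on skew-symmetric matrices, in coordinates. -/
def skewCongr {n : ℕ} : Matrix (Fin n) (Fin n) ℝ →* Module.End ℝ (SkewCoord n) where
  toFun N := ofSkew ∘ₗ (LinearMap.mulLeft ℝ N) ∘ₗ (LinearMap.mulRight ℝ Nᵀ) ∘ₗ toSkew
  map_one' := by
    apply LinearMap.ext
    intro x
    simp [ofSkew_toSkew]
  map_mul' N₁ N₂ := by
    apply LinearMap.ext
    intro x
    have h : (N₂ * (toSkew x * N₂ᵀ))ᵀ = -(N₂ * (toSkew x * N₂ᵀ)) := by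
      simp [transpose_mul, transpose_toSkew, Matrix.mul_assoc]
    simp [toSkew_ofSkew h, Matrix.mul_assoc, transpose_mul]

lemma skewCongr_apply {n : ℕ} (N : Matrix (Fin n) (Fin n) ℝ) (x : SkewCoord n) :
    skewCongr N x = ofSkew (N * (toSkew x * Nᵀ)) := rfl

lemma prod_lt_mul {n : ℕ} (d : Fin n → ℝ) :
    ∏ p : {p : Fin n × Fin n // p.1 < p.2}, d p.1.1 * d p.1.2 = (∏ i, d i) ^ (n - 1) := by
  rw [← Finset.prod_subtype (Finset.univ.filter fun p : Fin n × Fin n => p.1 < p.2) (by simp)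
    (fun p => d p.1 * d p.2), Finset.prod_mul_distrib, Finset.prod_filter, Finset.prod_filter,
    ← Finset.univ_product_univ, Finset.prod_product, Finset.prod_product_right,
    ← Finset.prod_mul_distrib, ← Finset.prod_pow]
  refine Finset.prod_congr rfl fun i _ => ?_
  dsimp only
  rw [← Finset.prod_filter, ← Finset.prod_filter, Finset.prod_const, Finset.prod_const, ← pow_add]
  have h₁ : (Finset.univ.filter fun j => i < j).card = n - 1 - i := by
    rw [← Fin.card_Ioi]; congr 1; ext; simp
  have h₂ : (Finset.univ.filter fun j => j < i).card = i := by
    rw [← Fin.card_Iio]; congr 1; ext; simp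
  rw [h₁, h₂]
  congr 1
  omega

lemma det_skewCongr_diagonal {n : ℕ} (d : Fin n → ℝ) :
    LinearMap.det (skewCongr (diagonal d)) = (diagonal d).det ^ (n - 1) := by
  rw [det_diagonal, ← prod_lt_mul]
  have : skewCongr (diagonal d) =
      Matrix.toLin' (diagonal fun p : {p : Fin n × Fin n // p.1 < p.2} => d p.1.1 * d p.1.2) := by
    apply LinearMap.ext
    intro x
    ext p
    simp [skewCongr_apply, ofSkew_apply, toSkew_apply, p.2, mulVec_diagonal, diagonal_transpose]
    ring
  rw [this, LinearMap.det_toLin', det_diagonal]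

lemma det_skewCongr_transvection {n : ℕ} {i j : Fin n} (hij : i ≠ j) (c : ℝ) :
    LinearMap.det (skewCongr (transvection i j c)) = 1 := by
  set a := LinearMap.det (skewCongr (transvection i j c)) with ha
  set D : Matrix (Fin n) (Fin n) ℝ := diagonal fun k => if k = i then 2 else 1 with hD
  have hcomm : D * transvection i j c = transvection i j c * transvection i j c * D := by
    rw [transvection_mul_transvection_same _ _ hij]
    ext k l
    simp only [hD, diagonal_mul, mul_diagonal, transvection, Matrix.add_apply, Matrix.one_apply,
      Matrix.single_apply]
    split_ifs <;> grind
  have hinv : a * LinearMap.det (skewCongr (transvection i j (-c))) = 1 := by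
    rw [ha, ← map_mul, ← map_mul, transvection_mul_transvection_same _ _ hij]
    simp [transvection_zero]
  have hDne : LinearMap.det (skewCongr D) ≠ 0 := by
    rw [hD, det_skewCongr_diagonal, det_diagonal]
    refine pow_ne_zero _ (Finset.prod_ne_zero_iff.2 fun k _ => ?_)
    split_ifs <;> norm_num
  have h := congrArg (fun X => LinearMap.det (skewCongr X)) hcomm
  simp only [map_mul, ← ha] at h
  have ha0 : a ≠ 0 := left_ne_zero_of_mul_eq_one hinv
  have : a * (LinearMap.det (skewCongr D)) * (a - 1) = 0 := by linear_combination -h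
  have := (mul_eq_zero.1 this).resolve_left (mul_ne_zero ha0 hDne)
  linarith

lemma det_skewCongr {n : ℕ} (N : Matrix (Fin n) (Fin n) ℝ) :
    LinearMap.det (skewCongr N) = N.det ^ (n - 1) := by
  refine diagonal_transvection_induction
    (fun N => LinearMap.det (skewCongr N) = N.det ^ (n - 1)) N
    (fun d _ => det_skewCongr_diagonal d) (fun t => ?_) fun A B hA hB => ?_
  · rw [TransvectionStruct.det, one_pow]
    exact det_skewCongr_transvection t.hij t.c
  · rw [map_mul, map_mul, hA, hB, det_mul, mul_pow]

lemma finrank_skewCoord (n : ℕ) : Module.finrank ℝ (SkewCoord n) = n * (n - 1) / 2 := by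
  have h := prod_lt_mul (n := n) fun _ => (2 : ℝ)
  simp only [Finset.prod_const, Finset.card_univ, Fintype.card_fin] at h
  have h' : (2 : ℝ) ^ (2 * Fintype.card {p : Fin n × Fin n // p.1 < p.2}) =
      2 ^ (n * (n - 1)) := by
    rw [pow_mul, pow_mul, ← h]
    norm_num
  have := pow_right_injective₀ (by norm_num : (0 : ℝ) < 2) (by norm_num) h'
  rw [Module.finrank_fintype_fun_eq_card]
  omega

/-! ### Algebra of the Cayley transform -/

lemma dotProduct_mulVec_self_of_skew {n : ℕ} {A : Matrix (Fin n) (Fin n) ℝ} (hA : Aᵀ = -A)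
    (v : Fin n → ℝ) : v ⬝ᵥ A *ᵥ v = 0 := by
  have h : v ⬝ᵥ A *ᵥ v = -(v ⬝ᵥ A *ᵥ v) := by
    conv_lhs => rw [dotProduct_mulVec, dotProduct_comm, ← mulVec_transpose, hA, neg_mulVec,
      dotProduct_neg]
  linarith

lemma det_one_sub_ne_zero_of_skew {n : ℕ} {A : Matrix (Fin n) (Fin n) ℝ} (hA : Aᵀ = -A) :
    (1 - A).det ≠ 0 := by
  intro h
  obtain ⟨v, hv, hv0⟩ := exists_mulVec_eq_zero_iff.2 h
  rw [sub_mulVec, one_mulVec, sub_eq_zero] at hv0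
  apply hv
  rw [← dotProduct_self_eq_zero]
  nth_rewrite 2 [hv0]
  exact dotProduct_mulVec_self_of_skew hA v

lemma det_one_add_eq_det_one_sub_of_skew {n : ℕ} {A : Matrix (Fin n) (Fin n) ℝ} (hA : Aᵀ = -A) :
    (1 + A).det = (1 - A).det := by
  rw [← det_transpose, transpose_add, transpose_one, hA, sub_eq_add_neg]

lemma det_one_add_ne_zero_of_skew {n : ℕ} {A : Matrix (Fin n) (Fin n) ℝ} (hA : Aᵀ = -A) :
    (1 + A).det ≠ 0 := by
  rw [det_one_add_eq_det_one_sub_of_skew hA]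
  exact det_one_sub_ne_zero_of_skew hA

lemma one_add_cayley {n : ℕ} {A : Matrix (Fin n) (Fin n) ℝ} (hA : Aᵀ = -A) :
    1 + cayley A = (2 : ℝ) • (1 - A)⁻¹ := by
  have h : (1 - A)⁻¹ * (1 - A) = 1 :=
    nonsing_inv_mul _ (det_one_sub_ne_zero_of_skew hA).isUnit
  rw [cayley]
  nth_rewrite 1 [← h]
  rw [← Matrix.mul_add]
  have : 1 - A + (1 + A) = (2 : ℝ) • (1 : Matrix (Fin n) (Fin n) ℝ) := by
    rw [two_smul]; abel
  rw [this, Matrix.mul_smul, Matrix.mul_one]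

lemma det_one_add_cayley_ne_zero {n : ℕ} {A : Matrix (Fin n) (Fin n) ℝ} (hA : Aᵀ = -A) :
    (1 + cayley A).det ≠ 0 := by
  rw [one_add_cayley hA, det_smul, det_nonsing_inv]
  have := det_one_sub_ne_zero_of_skew hA
  simp [this]

lemma invCayley_eq {n : ℕ} {Q : Matrix (Fin n) (Fin n) ℝ} (hQ : (1 + Q).det ≠ 0) :
    invCayley Q = 1 - (2 : ℝ) • (1 + Q)⁻¹ := by
  have h : (1 + Q) * (1 + Q)⁻¹ = 1 := mul_nonsing_inv _ hQ.isUnit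
  have : Q - 1 = (1 + Q) - (2 : ℝ) • (1 : Matrix (Fin n) (Fin n) ℝ) := by
    rw [two_smul]; abel
  rw [invCayley, this, Matrix.sub_mul, h, Matrix.smul_mul, Matrix.one_mul]

lemma invCayley_cayley {n : ℕ} {A : Matrix (Fin n) (Fin n) ℝ} (hA : Aᵀ = -A) :
    invCayley (cayley A) = A := by
  rw [invCayley_eq (det_one_add_cayley_ne_zero hA), one_add_cayley hA]
  have h := det_one_sub_ne_zero_of_skew hA
  have : ((2 : ℝ) • (1 - A)⁻¹)⁻¹ = (2 : ℝ)⁻¹ • (1 - A) := by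
    apply inv_eq_right_inv
    rw [Matrix.smul_mul, Matrix.mul_smul, smul_smul, nonsing_inv_mul _ h.isUnit]
    simp
  rw [this, smul_smul]
  simp

lemma cayley_invCayley {n : ℕ} {Q : Matrix (Fin n) (Fin n) ℝ} (hQ : (1 + Q).det ≠ 0) :
    cayley (invCayley Q) = Q := by
  have h : (1 + Q) * (1 + Q)⁻¹ = 1 := mul_nonsing_inv _ hQ.isUnit
  have h₁ : (1 - invCayley Q) = (2 : ℝ) • (1 + Q)⁻¹ := by
    rw [invCayley_eq hQ]; abel
  have h₂ : (1 - invCayley Q)⁻¹ = (2 : ℝ)⁻¹ • (1 + Q) := by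
    rw [h₁]
    apply inv_eq_left_inv
    rw [Matrix.smul_mul, Matrix.mul_smul, smul_smul, h]
    simp
  have h₃ : 1 + invCayley Q = (2 : ℝ) • (1 - (1 + Q)⁻¹) := by
    rw [invCayley_eq hQ, smul_sub, two_smul ℝ (1 : Matrix (Fin n) (Fin n) ℝ)]; abel
  rw [cayley, h₂, h₃, Matrix.smul_mul, Matrix.mul_smul, smul_smul, Matrix.mul_sub, h]
  simp

lemma transpose_invCayley {n : ℕ} {Q : Matrix (Fin n) (Fin n) ℝ} (hQ : (1 + Q).det ≠ 0)
    (hO : Qᵀ * Q = 1) : (invCayley Q)ᵀ = -invCayley Q := by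
  have h : (1 + Q) * (1 + Q)⁻¹ = 1 := mul_nonsing_inv _ hQ.isUnit
  have hT : (1 + Qᵀ)⁻¹ * (1 + Qᵀ) = 1 := by
    apply nonsing_inv_mul
    rw [← transpose_one, ← transpose_add, det_transpose]
    exact hQ.isUnit
  have key : (Qᵀ - 1) * (1 + Q) = -((1 + Qᵀ) * (Q - 1)) := by
    simp only [Matrix.sub_mul, Matrix.mul_add, Matrix.add_mul, Matrix.mul_sub, hO, Matrix.mul_one,
      Matrix.one_mul]
    abel
  calc (invCayley Q)ᵀ = (1 + Qᵀ)⁻¹ * (Qᵀ - 1) * ((1 + Q) * (1 + Q)⁻¹) := by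
        simp [invCayley, transpose_mul, transpose_nonsing_inv, h]
    _ = (1 + Qᵀ)⁻¹ * ((Qᵀ - 1) * (1 + Q)) * (1 + Q)⁻¹ := by simp only [Matrix.mul_assoc]
    _ = -((1 + Qᵀ)⁻¹ * (1 + Qᵀ) * ((Q - 1) * (1 + Q)⁻¹)) := by
        rw [key]; simp only [Matrix.mul_assoc, Matrix.mul_neg, Matrix.neg_mul]
    _ = -invCayley Q := by rw [hT, Matrix.one_mul, invCayley]

lemma commute_one_sub_one_add {n : ℕ} (A : Matrix (Fin n) (Fin n) ℝ) :
    (1 - A) * (1 + A) = (1 + A) * (1 - A) := by noncomm_ring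

lemma cayley_eq_mul_inv {n : ℕ} {A : Matrix (Fin n) (Fin n) ℝ} (hA : Aᵀ = -A) :
    cayley A = (1 + A) * (1 - A)⁻¹ := by
  have h : (1 - A)⁻¹ * (1 - A) = 1 :=
    nonsing_inv_mul _ (det_one_sub_ne_zero_of_skew hA).isUnit
  have h' : (1 - A) * (1 - A)⁻¹ = 1 :=
    mul_nonsing_inv _ (det_one_sub_ne_zero_of_skew hA).isUnit
  calc cayley A = (1 - A)⁻¹ * ((1 + A) * (1 - A)) * (1 - A)⁻¹ := by
        rw [cayley]; simp only [Matrix.mul_assoc, h', Matrix.mul_one]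
    _ = (1 - A)⁻¹ * (1 - A) * ((1 + A) * (1 - A)⁻¹) := by
        rw [← commute_one_sub_one_add]; simp only [Matrix.mul_assoc]
    _ = _ := by rw [h, Matrix.one_mul]

lemma transpose_cayley {n : ℕ} {A : Matrix (Fin n) (Fin n) ℝ} (hA : Aᵀ = -A) :
    (cayley A)ᵀ = (1 - A) * (1 + A)⁻¹ := by
  simp [cayley, transpose_mul, transpose_nonsing_inv, hA, sub_eq_add_neg]

lemma transpose_cayley_mul_cayley {n : ℕ} {A : Matrix (Fin n) (Fin n) ℝ} (hA : Aᵀ = -A) :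
    (cayley A)ᵀ * cayley A = 1 := by
  have h : (1 + A)⁻¹ * (1 + A) = 1 :=
    nonsing_inv_mul _ (det_one_add_ne_zero_of_skew hA).isUnit
  have h' : (1 - A) * (1 - A)⁻¹ = 1 :=
    mul_nonsing_inv _ (det_one_sub_ne_zero_of_skew hA).isUnit
  rw [transpose_cayley hA, cayley_eq_mul_inv hA, Matrix.mul_assoc, ← Matrix.mul_assoc _ (1 + A),
    h, Matrix.one_mul, h']

lemma det_cayley {n : ℕ} {A : Matrix (Fin n) (Fin n) ℝ} (hA : Aᵀ = -A) :
    (cayley A).det = 1 := by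
  rw [cayley, det_mul, det_one_add_eq_det_one_sub_of_skew hA, ← det_mul, nonsing_inv_mul, det_one]
  exact (det_one_sub_ne_zero_of_skew hA).isUnit

lemma det_sub_smul_one_ne_zero {n : ℕ} {Q : Matrix (Fin n) (Fin n) ℝ} (hO : Qᵀ * Q = 1)
    {t : ℝ} (ht0 : 0 ≤ t) (ht1 : t < 1) : (Q - t • (1 : Matrix (Fin n) (Fin n) ℝ)).det ≠ 0 := by
  intro h
  obtain ⟨v, hv, hv0⟩ := exists_mulVec_eq_zero_iff.2 h
  rw [sub_mulVec, smul_mulVec, one_mulVec, sub_eq_zero] at hv0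
  apply hv
  have h₁ : (Q *ᵥ v) ⬝ᵥ (Q *ᵥ v) = v ⬝ᵥ v := by
    rw [dotProduct_mulVec, ← mulVec_transpose, mulVec_mulVec, hO, one_mulVec]
  rw [hv0, smul_dotProduct, dotProduct_smul, smul_eq_mul, smul_eq_mul] at h₁
  rw [← dotProduct_self_eq_zero]
  have h₂ : (1 - t * t) * (v ⬝ᵥ v) = 0 := by linear_combination -h₁
  exact (mul_eq_zero.1 h₂).resolve_left (by nlinarith)

lemma det_sub_smul_one_pos {n : ℕ} {Q : Matrix (Fin n) (Fin n) ℝ} (hO : Qᵀ * Q = 1)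
    (hdet : Q.det = 1) {t : ℝ} (ht0 : 0 ≤ t) (ht1 : t < 1) :
    0 < (Q - t • (1 : Matrix (Fin n) (Fin n) ℝ)).det := by
  by_contra! hle
  have hcont : Continuous fun s : ℝ => (Q - s • (1 : Matrix (Fin n) (Fin n) ℝ)).det :=
    Continuous.matrix_det (by fun_prop)
  obtain ⟨s, hs, hs0⟩ := intermediate_value_Icc' ht0 hcont.continuousOn
    (show (0 : ℝ) ∈ Set.Icc _ _ from ⟨hle, by simp [hdet]⟩)
  exact det_sub_smul_one_ne_zero hO hs.1 (hs.2.trans_lt ht1) hs0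

/-! ### Left translations in Cayley coordinates -/

/-- Left translation by `h` of an orthogonal matrix, read in Cayley coordinates. -/
noncomputable def cayleyTranslate {n : ℕ} (h : Matrix (Fin n) (Fin n) ℝ) (x : SkewCoord n) :
    SkewCoord n :=
  ofSkew (invCayley (h * cayley (toSkew x)))

/-- The matrix whose congruence is the derivative of `cayleyTranslate h` at `x`. -/
noncomputable def cayleyTranslateFactor {n : ℕ} (h : Matrix (Fin n) (Fin n) ℝ)
    (x : SkewCoord n) : Matrix (Fin n) (Fin n) ℝ :=
  (2 : ℝ) • ((1 + h * cayley (toSkew x))⁻¹ * h * (1 - toSkew x)⁻¹)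

lemma orthogonal_mul {n : ℕ} {P Q : Matrix (Fin n) (Fin n) ℝ} (hP : Pᵀ * P = 1)
    (hQ : Qᵀ * Q = 1) : (P * Q)ᵀ * (P * Q) = 1 := by
  rw [transpose_mul, Matrix.mul_assoc, ← Matrix.mul_assoc Pᵀ, hP, Matrix.one_mul, hQ]

lemma toSkew_cayleyTranslate {n : ℕ} {h : Matrix (Fin n) (Fin n) ℝ} (hO : hᵀ * h = 1)
    {x : SkewCoord n} (hx : (1 + h * cayley (toSkew x)).det ≠ 0) :
    toSkew (cayleyTranslate h x) = invCayley (h * cayley (toSkew x)) :=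
  toSkew_ofSkew (transpose_invCayley hx
    (orthogonal_mul hO (transpose_cayley_mul_cayley (transpose_toSkew x))))

lemma cayley_cayleyTranslate {n : ℕ} {h : Matrix (Fin n) (Fin n) ℝ} (hO : hᵀ * h = 1)
    {x : SkewCoord n} (hx : (1 + h * cayley (toSkew x)).det ≠ 0) :
    cayley (toSkew (cayleyTranslate h x)) = h * cayley (toSkew x) := by
  rw [toSkew_cayleyTranslate hO hx, cayley_invCayley hx]

lemma injOn_cayleyTranslate {n : ℕ} {h : Matrix (Fin n) (Fin n) ℝ} (hO : hᵀ * h = 1) :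
    Set.InjOn (cayleyTranslate h) {x | (1 + h * cayley (toSkew x)).det ≠ 0} := by
  intro x hx y hy hxy
  have h₁ : h * cayley (toSkew x) = h * cayley (toSkew y) := by
    rw [← cayley_cayleyTranslate hO hx, hxy, cayley_cayleyTranslate hO hy]
  have h₂ : cayley (toSkew x) = cayley (toSkew y) := by
    simpa [← Matrix.mul_assoc, hO] using congrArg (hᵀ * ·) h₁
  rw [← ofSkew_toSkew x, ← invCayley_cayley (transpose_toSkew x), h₂,
    invCayley_cayley (transpose_toSkew y), ofSkew_toSkew]

lemma transpose_cayleyTranslateFactor {n : ℕ} {h : Matrix (Fin n) (Fin n) ℝ} (hO : hᵀ * h = 1)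
    {x : SkewCoord n} (hx : (1 + h * cayley (toSkew x)).det ≠ 0) :
    (cayleyTranslateFactor h x)ᵀ =
      (2 : ℝ) • ((1 - toSkew x)⁻¹ * (1 + h * cayley (toSkew x))⁻¹) := by
  set A := toSkew x with hA
  have hAs : Aᵀ = -A := transpose_toSkew x
  set Q := h * cayley A with hQ
  have hQO : Qᵀ * Q = 1 := orthogonal_mul hO (transpose_cayley_mul_cayley hAs)
  have hQO' : Q * Qᵀ = 1 := mul_eq_one_comm.1 hQO
  have hO' : h * hᵀ = 1 := mul_eq_one_comm.1 hO
  have hS : (1 + Q)⁻¹ * (1 + Q) = 1 := nonsing_inv_mul _ hx.isUnit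
  have hR : (1 - A)⁻¹ * (1 - A) = 1 :=
    nonsing_inv_mul _ (det_one_sub_ne_zero_of_skew hAs).isUnit
  have hR' : (1 + A)⁻¹ * (1 + A) = 1 :=
    nonsing_inv_mul _ (det_one_add_ne_zero_of_skew hAs).isUnit
  have hinv : (1 + Q)⁻¹ * h * (1 - A)⁻¹ = ((1 - A) * hᵀ * (1 + Q))⁻¹ := by
    symm
    apply inv_eq_left_inv
    calc (1 + Q)⁻¹ * h * (1 - A)⁻¹ * ((1 - A) * hᵀ * (1 + Q))
        = (1 + Q)⁻¹ * (h * (((1 - A)⁻¹ * (1 - A)) * hᵀ)) * (1 + Q) := by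
          simp only [Matrix.mul_assoc]
      _ = 1 := by rw [hR, Matrix.one_mul, hO', Matrix.mul_one, hS]
  have hfac : (1 + Qᵀ) = (1 + Q) * Qᵀ := by
    rw [Matrix.add_mul, hQO', Matrix.one_mul, add_comm]
  have hQh : Qᵀ * h = (1 - A) * (1 + A)⁻¹ := by
    rw [hQ, transpose_mul, Matrix.mul_assoc, hO, Matrix.mul_one, transpose_cayley hAs]
  rw [cayleyTranslateFactor, transpose_smul, hinv, transpose_nonsing_inv]
  congr 1
  apply inv_eq_left_inv
  have hW : ((1 - A) * hᵀ * (1 + Q))ᵀ = (1 + Q) * ((1 - A) * ((1 + A)⁻¹ * (1 + A))) := by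
    rw [← Matrix.mul_assoc (1 - A), ← hQh, ← Matrix.mul_assoc, ← Matrix.mul_assoc, ← hfac]
    simp [transpose_mul, hAs, Matrix.mul_assoc]
  rw [hW, hR', Matrix.mul_one, Matrix.mul_assoc, ← Matrix.mul_assoc _ (1 + Q), hS,
    Matrix.one_mul, hR]

lemma det_cayleyTranslateFactor {n : ℕ} {h : Matrix (Fin n) (Fin n) ℝ} (hO : hᵀ * h = 1)
    (hdet : h.det = 1) {x : SkewCoord n} (hx : (1 + h * cayley (toSkew x)).det ≠ 0) :
    (cayleyTranslateFactor h x).det * (1 + toSkew x).det =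
      (1 + toSkew (cayleyTranslate h x)).det := by
  have hAs := transpose_toSkew x
  have hne := det_one_add_ne_zero_of_skew hAs
  rw [toSkew_cayleyTranslate hO hx]
  set Q := h * cayley (toSkew x) with hQ
  have hS : (1 + Q)⁻¹ * (1 + Q) = 1 := nonsing_inv_mul _ hx.isUnit
  have h₁ : 1 + invCayley Q = (2 : ℝ) • ((1 + Q)⁻¹ * Q) := by
    have : (1 + Q)⁻¹ * Q = 1 - (1 + Q)⁻¹ := by
      rw [eq_sub_iff_add_eq']
      rwa [Matrix.mul_add, Matrix.mul_one] at hS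
    rw [invCayley_eq hx, this, smul_sub, two_smul ℝ (1 : Matrix (Fin n) (Fin n) ℝ)]
    abel
  have hQdet : Q.det = 1 := by rw [hQ, det_mul, hdet, det_cayley hAs, one_mul]
  rw [h₁, cayleyTranslateFactor, det_smul, det_smul, det_mul, det_mul, det_mul, hQdet, hdet,
    ← hQ, det_nonsing_inv (1 - _), ← det_one_add_eq_det_one_sub_of_skew hAs, Ring.inverse_eq_inv']
  field_simp

lemma continuous_toSkew {n : ℕ} : Continuous (toSkew : SkewCoord n → _) :=
  LinearMap.continuous_of_finiteDimensional _

open scoped Matrix.Norms.Operator in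
lemma hasFDerivAt_cayleyTranslate {n : ℕ} {h : Matrix (Fin n) (Fin n) ℝ} (hO : hᵀ * h = 1)
    {x : SkewCoord n} (hx : (1 + h * cayley (toSkew x)).det ≠ 0) :
    HasFDerivAt (cayleyTranslate h)
      (LinearMap.toContinuousLinearMap (skewCongr (cayleyTranslateFactor h x))) x := by
  have hAs := transpose_toSkew x
  have hinv : ∀ {f : SkewCoord n → Matrix (Fin n) (Fin n) ℝ} {f'}, HasFDerivAt f f' x →
      (f x).det ≠ 0 → HasFDerivAt (fun y => (f y)⁻¹)
        ((-ContinuousLinearMap.mulLeftRight ℝ _ (f x)⁻¹ (f x)⁻¹).comp f') x := by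
    intro f f' hf hne
    obtain ⟨u, hu⟩ := (Matrix.isUnit_iff_isUnit_det _).2 hne.isUnit
    have hi := hasFDerivAt_ringInverse (𝕜 := ℝ) u
    have hu' : (↑u⁻¹ : Matrix (Fin n) (Fin n) ℝ) = (f x)⁻¹ := by
      rw [← hu, Matrix.coe_units_inv]
    rw [hu, hu'] at hi
    have := hi.comp x hf
    simpa only [Function.comp_def, ← Matrix.nonsing_inv_eq_ringInverse] using! this
  let T : SkewCoord n →L[ℝ] Matrix (Fin n) (Fin n) ℝ := LinearMap.toContinuousLinearMap toSkew
  let O : Matrix (Fin n) (Fin n) ℝ →L[ℝ] SkewCoord n := LinearMap.toContinuousLinearMap ofSkew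
  have hT : HasFDerivAt (fun y => toSkew y) T x := T.hasFDerivAt
  have h₁ := hinv (hT.const_sub 1) (det_one_sub_ne_zero_of_skew hAs)
  have h₂ := (h₁.mul' (hT.const_add 1)).const_mul h
  have h₃ := hinv (h₂.const_add 1) hx
  have h₄ := O.hasFDerivAt.comp x ((h₂.sub_const 1).mul' h₃)
  refine HasFDerivAt.congr_fderiv h₄ ?_
  ext1 v
  set A := toSkew x with hA
  set R := (1 - A)⁻¹ with hR
  have hC : R * (1 + A) = cayley A := rfl
  have hC₁ : 1 + cayley A = (2 : ℝ) • R := one_add_cayley hAs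
  have hB : 1 - (h * cayley A - 1) * (1 + h * cayley A)⁻¹ =
      (2 : ℝ) • (1 + h * cayley A)⁻¹ := by
    rw [← invCayley, invCayley_eq hx]
    abel
  set S := (1 + h * cayley A)⁻¹ with hS
  set V := toSkew v with hV
  have hdC : R * V + -(R * -V * R) * (1 + A) = (2 : ℝ) • (R * V * R) := by
    simp only [Matrix.mul_neg, Matrix.neg_mul, neg_neg]
    rw [Matrix.mul_assoc _ R, hC]
    nth_rewrite 1 [← Matrix.mul_one (R * V)]
    rw [← Matrix.mul_add, hC₁, Matrix.mul_smul]
  have hdB : (h * cayley A - 1) * -(S * (h * (R * V + -(R * -V * R) * (1 + A))) * S) +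
      h * (R * V + -(R * -V * R) * (1 + A)) * S =
      cayleyTranslateFactor h x * (V * (cayleyTranslateFactor h x)ᵀ) := by
    have hXY : ∀ X Y : Matrix (Fin n) (Fin n) ℝ, X * -(S * Y * S) + Y * S =
        (1 - X * S) * (Y * S) := fun X Y => by noncomm_ring
    rw [hdC, transpose_cayleyTranslateFactor hO hx, cayleyTranslateFactor, ← hA, ← hR, ← hS, hXY,
      hB]
    simp only [Matrix.smul_mul, Matrix.mul_smul, Matrix.mul_assoc]
  exact congrArg ofSkew hdB

/-! ### The Cayley measure -/

instance {n : ℕ} : SecondCountableTopology (Matrix (Fin n) (Fin n) ℝ) :=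
  inferInstanceAs (SecondCountableTopology (Fin n → Fin n → ℝ))

lemma measurable_matrix_inv {n : ℕ} :
    Measurable fun A : Matrix (Fin n) (Fin n) ℝ => A⁻¹ := by
  have h : Continuous fun A : Matrix (Fin n) (Fin n) ℝ => A.det := continuous_id.matrix_det
  have h' : Continuous fun A : Matrix (Fin n) (Fin n) ℝ => A.adjugate :=
    continuous_id.matrix_adjugate
  simp only [Matrix.inv_def, Ring.inverse_eq_inv']
  exact h.measurable.inv.smul h'.measurable

lemma measurable_cayley {n : ℕ} :
    Measurable (cayley : Matrix (Fin n) (Fin n) ℝ → Matrix (Fin n) (Fin n) ℝ) :=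
  (measurable_matrix_inv.comp (measurable_const.sub measurable_id)).mul
    (measurable_const.add measurable_id)

lemma measurable_invCayley {n : ℕ} :
    Measurable (invCayley : Matrix (Fin n) (Fin n) ℝ → Matrix (Fin n) (Fin n) ℝ) :=
  (measurable_id.sub measurable_const).mul
    (measurable_matrix_inv.comp (measurable_const.add measurable_id))

lemma measurable_cayley_toSkew {n : ℕ} :
    Measurable fun x : SkewCoord n => cayley (toSkew x) :=
  measurable_cayley.comp continuous_toSkew.measurable

lemma measurable_matrix_det {n : ℕ} : Measurable fun A : Matrix (Fin n) (Fin n) ℝ => A.det :=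
  Continuous.measurable (continuous_id.matrix_det)

/-- A measurable set meeting every line through the origin in a null set is null. -/
lemma volume_eq_zero_of_forall_line {n : ℕ} {N : Set (SkewCoord n)} (hN : MeasurableSet N)
    (h : ∀ x : SkewCoord n, volume {t : ℝ | t • x ∈ N} = 0) : volume N = 0 := by
  have hZ : MeasurableSet {p : SkewCoord n × ℝ | p.2 • p.1 ∈ N} :=
    (measurable_snd.smul measurable_fst) hN
  have h₁ : (volume.prod volume) {p : SkewCoord n × ℝ | p.2 • p.1 ∈ N} = 0 := by
    rw [Measure.measure_prod_null hZ]
    exact Filter.Eventually.of_forall h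
  rw [← Measure.prod_swap, Measure.map_apply measurable_swap hZ,
    Measure.measure_prod_null (measurable_swap hZ)] at h₁
  have h₂ : ∀ᵐ t : ℝ, t ≠ 0 := by simp [ae_iff]
  obtain ⟨t, ht, ht0⟩ := (h₁.and h₂).exists
  have h₃ : volume ((t • ·) ⁻¹' N : Set (SkewCoord n)) = 0 := ht
  rw [Measure.addHaar_preimage_smul _ ht0, mul_eq_zero] at h₃
  refine h₃.resolve_left ?_
  simp [ht0]

lemma ae_det_one_add_mul_cayley_ne_zero {n : ℕ} {h : Matrix (Fin n) (Fin n) ℝ}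
    (hh : (1 + h).det ≠ 0) :
    ∀ᵐ x : SkewCoord n, (1 + h * cayley (toSkew x)).det ≠ 0 := by
  rw [ae_iff]
  simp only [not_not]
  refine volume_eq_zero_of_forall_line (measurableSet_eq_fun (measurable_matrix_det.comp
    (measurable_const.add (measurable_const.mul measurable_cayley_toSkew))) measurable_const)
    fun x => ?_
  set p : Polynomial ℝ := det ((Polynomial.X : Polynomial ℝ) •
    ((h - 1) * toSkew x).map Polynomial.C + (1 + h).map Polynomial.C) with hp
  have hp0 : p ≠ 0 := fun h0 => hh <| by
    rw [← Polynomial.coeff_det_X_add_C_zero ((h - 1) * toSkew x), ← hp, h0, Polynomial.coeff_zero]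
  refine measure_mono_null (fun t ht => ?_) (p.roots.toFinset.finite_toSet.measure_zero volume)
  simp only [Finset.mem_coe, Multiset.mem_toFinset, Polynomial.mem_roots hp0, Polynomial.IsRoot]
  have heval : p.eval t = (t • ((h - 1) * toSkew x) + (1 + h)).det := by
    rw [hp, ← Polynomial.coe_evalRingHom, RingHom.map_det]
    congr 1
    ext i j
    simp only [RingHom.mapMatrix_apply, Matrix.map_apply, Matrix.add_apply, Matrix.smul_apply,
      smul_eq_mul, Polynomial.coe_evalRingHom, Polynomial.eval_add, Polynomial.eval_mul,
      Polynomial.eval_X, Polynomial.eval_C]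
  have hAs := transpose_toSkew (t • x)
  have hR : (1 - toSkew (t • x))⁻¹ * (1 - toSkew (t • x)) = 1 :=
    nonsing_inv_mul _ (det_one_sub_ne_zero_of_skew hAs).isUnit
  have hmul : t • ((h - 1) * toSkew x) + (1 + h) =
      (1 + h * cayley (toSkew (t • x))) * (1 - toSkew (t • x)) := by
    rw [cayley_eq_mul_inv hAs, Matrix.add_mul, Matrix.mul_assoc, Matrix.mul_assoc, hR, map_smul]
    simp only [Matrix.sub_mul, Matrix.mul_add, Matrix.mul_one, Matrix.one_mul, smul_sub,
      Matrix.mul_smul]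
    abel
  have ht' : (1 + h * cayley (toSkew (t • x))).det = 0 := ht
  rw [heval, hmul, det_mul, ht', zero_mul]

/-- The density of Haar measure on the special orthogonal group in Cayley coordinates, up to a
multiplicative constant. -/
noncomputable def cayleyDensity {n : ℕ} (x : SkewCoord n) : ENNReal :=
  ENNReal.ofReal (|(1 + toSkew x).det| ^ (n - 1))⁻¹

/-- The unnormalized Haar measure on the special orthogonal group, as the image of a measure with
density under the Cayley transform. -/
noncomputable def cayleyMeasure (n : ℕ) : Measure (Matrix (Fin n) (Fin n) ℝ) :=
  (volume.withDensity cayleyDensity).map fun x : SkewCoord n => cayley (toSkew x)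

lemma continuous_cayleyDensity_toReal {n : ℕ} :
    Continuous fun x : SkewCoord n => (|(1 + toSkew x).det| ^ (n - 1))⁻¹ := by
  refine Continuous.inv₀ ?_ fun x =>
    pow_ne_zero _ (abs_ne_zero.2 (det_one_add_ne_zero_of_skew (transpose_toSkew x)))
  exact ((continuous_const.add continuous_toSkew).matrix_det.abs).pow _

lemma measurable_cayleyDensity {n : ℕ} : Measurable (cayleyDensity : SkewCoord n → ENNReal) :=
  continuous_cayleyDensity_toReal.measurable.ennreal_ofReal

instance {n : ℕ} : SFinite (cayleyMeasure n) := by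
  unfold cayleyMeasure
  infer_instance

lemma lintegral_cayleyMeasure {n : ℕ} {F : Matrix (Fin n) (Fin n) ℝ → ENNReal}
    (hF : Measurable F) :
    ∫⁻ P, F P ∂cayleyMeasure n = ∫⁻ x : SkewCoord n, cayleyDensity x * F (cayley (toSkew x)) := by
  rw [cayleyMeasure, lintegral_map hF measurable_cayley_toSkew,
    lintegral_withDensity_eq_lintegral_mul _ measurable_cayleyDensity
      (g := fun x => F (cayley (toSkew x))) (hF.comp measurable_cayley_toSkew)]
  rfl

lemma cayleyDensity_cayleyTranslate {n : ℕ} {h : Matrix (Fin n) (Fin n) ℝ} (hO : hᵀ * h = 1)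
    (hdet : h.det = 1) {x : SkewCoord n} (hx : (1 + h * cayley (toSkew x)).det ≠ 0) :
    ENNReal.ofReal |LinearMap.det (skewCongr (cayleyTranslateFactor h x))| *
      cayleyDensity (cayleyTranslate h x) = cayleyDensity x := by
  have h₁ := det_one_add_ne_zero_of_skew (transpose_toSkew x)
  have h₂ := det_one_add_ne_zero_of_skew (transpose_toSkew (cayleyTranslate h x))
  have h₃ := det_cayleyTranslateFactor hO hdet hx
  rw [cayleyDensity, cayleyDensity, ← ENNReal.ofReal_mul (abs_nonneg _), det_skewCongr, abs_pow,
    ← h₃, abs_mul, mul_pow]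
  rw [← h₃] at h₂
  have h₄ := left_ne_zero_of_mul h₂
  have h₅ : |(cayleyTranslateFactor h x).det| ^ (n - 1) ≠ 0 := pow_ne_zero _ (abs_ne_zero.2 h₄)
  rw [mul_inv, mul_inv_cancel_left₀ h₅]

lemma lintegral_cayleyMeasure_mul_le {n : ℕ} {h : Matrix (Fin n) (Fin n) ℝ} (hO : hᵀ * h = 1)
    (hdet : h.det = 1) (hh : (1 + h).det ≠ 0) {F : Matrix (Fin n) (Fin n) ℝ → ENNReal}
    (hF : Measurable F) :
    ∫⁻ P, F (h * P) ∂cayleyMeasure n ≤ ∫⁻ P, F P ∂cayleyMeasure n := by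
  rw [lintegral_cayleyMeasure hF,
    lintegral_cayleyMeasure (F := fun P => F (h * P))
      (hF.comp (measurable_const.mul measurable_id))]
  set s := {x : SkewCoord n | (1 + h * cayley (toSkew x)).det ≠ 0} with hs
  have hsm : MeasurableSet s := (measurableSet_eq_fun (measurable_matrix_det.comp
    (measurable_const.add (measurable_const.mul measurable_cayley_toSkew)))
    measurable_const).compl
  have hsae : ∀ᵐ x : SkewCoord n, x ∈ s := ae_det_one_add_mul_cayley_ne_zero hh
  calc ∫⁻ x : SkewCoord n, cayleyDensity x * F (h * cayley (toSkew x))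
      = ∫⁻ x in s, cayleyDensity x * F (h * cayley (toSkew x)) := by
        rw [Measure.restrict_eq_self_of_ae_mem hsae]
    _ = ∫⁻ x in s, ENNReal.ofReal
          |(LinearMap.toContinuousLinearMap (skewCongr (cayleyTranslateFactor h x))).det| *
          (cayleyDensity (cayleyTranslate h x) * F (cayley (toSkew (cayleyTranslate h x)))) := by
        refine setLIntegral_congr_fun hsm fun x hx => ?_
        rw [cayley_cayleyTranslate hO hx, ← mul_assoc, ContinuousLinearMap.det,
          LinearMap.coe_toContinuousLinearMap, cayleyDensity_cayleyTranslate hO hdet hx]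
    _ = ∫⁻ y in cayleyTranslate h '' s, cayleyDensity y * F (cayley (toSkew y)) :=
        (lintegral_image_eq_lintegral_abs_det_fderiv_mul volume hsm
          (fun x hx => (hasFDerivAt_cayleyTranslate hO hx).hasFDerivWithinAt)
          (injOn_cayleyTranslate hO) fun y => cayleyDensity y * F (cayley (toSkew y))).symm
    _ ≤ ∫⁻ y : SkewCoord n, cayleyDensity y * F (cayley (toSkew y)) :=
        setLIntegral_le_lintegral _ _

/-! ### Invariance of the Cayley measure -/

/-- The Cayley measure is subinvariant under left multiplication by `h`. -/
def CayleySubinvariant {n : ℕ} (h : Matrix (Fin n) (Fin n) ℝ) : Prop :=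
  ∀ F : Matrix (Fin n) (Fin n) ℝ → ENNReal, Measurable F →
    ∫⁻ P, F (h * P) ∂cayleyMeasure n ≤ ∫⁻ P, F P ∂cayleyMeasure n

lemma CayleySubinvariant.one {n : ℕ} :
    CayleySubinvariant (1 : Matrix (Fin n) (Fin n) ℝ) := fun F _ => by
  simp only [Matrix.one_mul, le_refl]

lemma CayleySubinvariant.mul {n : ℕ} {h₁ h₂ : Matrix (Fin n) (Fin n) ℝ}
    (H₁ : CayleySubinvariant h₁) (H₂ : CayleySubinvariant h₂) :
    CayleySubinvariant (h₁ * h₂) := fun F hF => by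
  simp only [Matrix.mul_assoc]
  exact (H₂ (fun P => F (h₁ * P)) (hF.comp (measurable_const.mul measurable_id))).trans (H₁ F hF)

lemma cayleySubinvariant_of_det_one_add_ne_zero {n : ℕ} {h : Matrix (Fin n) (Fin n) ℝ}
    (hO : hᵀ * h = 1) (hdet : h.det = 1) (hh : (1 + h).det ≠ 0) : CayleySubinvariant h :=
  fun _ hF => lintegral_cayleyMeasure_mul_le hO hdet hh hF

lemma cayleySubinvariant_cayley {n : ℕ} {A : Matrix (Fin n) (Fin n) ℝ} (hA : Aᵀ = -A) :
    CayleySubinvariant (cayley A) :=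
  cayleySubinvariant_of_det_one_add_ne_zero (transpose_cayley_mul_cayley hA) (det_cayley hA)
    (det_one_add_cayley_ne_zero hA)

/-- The diagonal matrix with entries `-1` on `s` and `1` elsewhere. -/
def signDiagonal {n : ℕ} (s : Finset (Fin n)) : Matrix (Fin n) (Fin n) ℝ :=
  diagonal fun i => if i ∈ s then -1 else 1

lemma signDiagonal_mul_self {n : ℕ} (s : Finset (Fin n)) :
    signDiagonal s * signDiagonal s = 1 := by
  rw [signDiagonal, diagonal_mul_diagonal, ← diagonal_one]
  congr 1
  ext i
  split_ifs <;> norm_num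

lemma transpose_signDiagonal {n : ℕ} (s : Finset (Fin n)) :
    (signDiagonal s)ᵀ = signDiagonal s :=
  diagonal_transpose _

lemma det_signDiagonal {n : ℕ} (s : Finset (Fin n)) :
    (signDiagonal s).det = (-1) ^ s.card := by
  simp [signDiagonal, det_diagonal]

lemma cayley_mul_cayley_of_cube {n : ℕ} {A : Matrix (Fin n) (Fin n) ℝ} (hA : Aᵀ = -A)
    (h3 : A * A * A = -A) : cayley A * cayley A = 1 + (2 : ℝ) • (A * A) := by
  have h : (1 - A)⁻¹ * (1 - A) = 1 :=
    nonsing_inv_mul _ (det_one_sub_ne_zero_of_skew hA).isUnit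
  have h₁ : cayley A = 1 + A + A * A := by
    have : 1 + A = (1 - A) * (1 + A + A * A) := by
      have e : (1 - A) * (1 + A + A * A) = 1 - A * A * A := by noncomm_ring
      rw [e, h3, sub_neg_eq_add]
    conv_lhs => rw [cayley, this]
    rw [← Matrix.mul_assoc, h, Matrix.one_mul]
  have e : (1 + A + A * A) * (1 + A + A * A) =
      1 + (2 : ℝ) • (A * A) + ((2 : ℝ) • A + A * A + (2 : ℝ) • (A * A * A) + A * A * A * A) := by
    simp only [two_smul]
    noncomm_ring
  rw [h₁, e, h3, Matrix.neg_mul, smul_neg]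
  simp

lemma cayleySubinvariant_signDiagonal_pair {n : ℕ} {i j : Fin n} (hij : i ≠ j) :
    CayleySubinvariant (signDiagonal {i, j}) := by
  set A : Matrix (Fin n) (Fin n) ℝ := Matrix.single i j 1 - Matrix.single j i 1 with hA
  have hAs : Aᵀ = -A := by
    rw [hA, transpose_sub, transpose_single, transpose_single, neg_sub]
  have h2 : A * A = -(Matrix.single i i 1 + Matrix.single j j 1) := by
    simp [hA, Matrix.sub_mul, Matrix.mul_sub, hij, hij.symm]
    abel
  have h3 : A * A * A = -A := by
    rw [h2, hA]
    simp [Matrix.add_mul, Matrix.mul_sub, hij, hij.symm]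
    abel
  have h := (cayleySubinvariant_cayley hAs).mul (cayleySubinvariant_cayley hAs)
  rw [cayley_mul_cayley_of_cube hAs h3, h2] at h
  convert h using 1
  ext k l
  by_cases hkl : k = l
  · subst hkl
    by_cases hki : k = i
    · subst hki
      simp [signDiagonal, hij.symm]
      norm_num
    · by_cases hkj : k = j
      · subst hkj
        simp [signDiagonal, hij]
        norm_num
      · simp [signDiagonal, hki, hkj, Ne.symm hki, Ne.symm hkj]
  · have h1 : ∀ (m : Fin n) (c : ℝ), Matrix.single m m c k l = 0 := fun m c => by
      rw [Matrix.single_apply, if_neg]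
      rintro ⟨rfl, rfl⟩
      exact hkl rfl
    simp [signDiagonal, hkl, h1]

lemma cayleySubinvariant_signDiagonal {n : ℕ} (k : ℕ) (s : Finset (Fin n))
    (hs : s.card = 2 * k) : CayleySubinvariant (signDiagonal s) := by
  induction k generalizing s with
  | zero =>
    obtain rfl : s = ∅ := by simpa using hs
    simpa [signDiagonal] using CayleySubinvariant.one (n := n)
  | succ k ih =>
    obtain ⟨i, hi, j, hj, hij⟩ := Finset.one_lt_card.1 (by omega : 1 < s.card)
    have hsub : {i, j} ⊆ s := by
      intro x
      simp only [Finset.mem_insert, Finset.mem_singleton]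
      rintro (rfl | rfl) <;> assumption
    have hcard : (s \ {i, j}).card = 2 * k := by
      rw [Finset.card_sdiff_of_subset hsub, Finset.card_pair hij]
      omega
    have h := (cayleySubinvariant_signDiagonal_pair hij).mul (ih _ hcard)
    convert h using 1
    rw [signDiagonal, signDiagonal, signDiagonal, diagonal_mul_diagonal]
    congr 1
    ext x
    by_cases hx : x ∈ ({i, j} : Finset (Fin n))
    · simp [hx, hsub hx]
    · by_cases hxs : x ∈ s <;> simp [hx, hxs]

lemma exists_det_signDiagonal_add_ne_zero {n : ℕ} (A : Matrix (Fin n) (Fin n) ℝ) :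
    ∃ s : Finset (Fin n), (signDiagonal s + A).det ≠ 0 := by
  by_contra! hall
  have key : ∀ s : Finset (Fin n), ∀ d : Fin n → ℝ, (∀ i ∉ s, d i = 1 ∨ d i = -1) →
      (diagonal d + A).det = 0 := by
    intro s
    induction s using Finset.induction_on with
    | empty =>
      intro d hd
      rw [← hall (Finset.univ.filter fun i => d i = -1), signDiagonal]
      congr 3
      ext i
      rcases hd i (by simp) with h | h <;> norm_num [h]
    | insert i s hi ih =>
      intro d hd
      have hrow : ∀ t : ℝ, (diagonal (Function.update d i t) + A).det =
          t * ((diagonal d + A).updateRow i (Pi.single i 1)).det +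
            ((diagonal d + A).updateRow i (A i)).det := by
        intro t
        rw [← det_updateRow_smul, ← det_updateRow_add]
        congr 1
        ext k l
        by_cases hk : k = i
        · subst hk
          by_cases hl : k = l
          · subst hl; simp
          · simp [hl, Ne.symm hl]
        · by_cases hl : k = l
          · subst hl; simp [hk]
          · simp [hl, hk]
      have hval : ∀ t : ℝ, (t = 1 ∨ t = -1) →
          (diagonal (Function.update d i t) + A).det = 0 := by
        intro t ht
        refine ih _ fun j hj => ?_
        by_cases hji : j = i
        · subst hji; simpa using ht
        · rw [Function.update_of_ne hji]
          exact hd j (by simp [hji, hj])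
      have h₁ := hval 1 (Or.inl rfl)
      have h₂ := hval (-1) (Or.inr rfl)
      rw [hrow] at h₁ h₂
      have h₃ := hrow (d i)
      rw [Function.update_eq_self] at h₃
      rw [h₃]
      have h₄ : ((diagonal d + A).updateRow i (Pi.single i 1)).det = 0 := by linarith
      rw [h₄] at h₁ ⊢
      linarith
  refine (charpoly_monic (-A)).ne_zero (Polynomial.funext fun t => ?_)
  rw [eval_charpoly, sub_neg_eq_add, Polynomial.eval_zero]
  exact key Finset.univ (fun _ => t) (by simp)

lemma det_one_add_eq_zero_of_det_eq_neg_one {n : ℕ} {Q : Matrix (Fin n) (Fin n) ℝ}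
    (hO : Qᵀ * Q = 1) (hdet : Q.det = -1) : (1 + Q).det = 0 := by
  have h : (1 + Q) = (1 + Q)ᵀ * Q := by
    rw [transpose_add, transpose_one, Matrix.add_mul, hO, Matrix.one_mul, add_comm]
  have h' := congrArg det h
  rw [det_mul, det_transpose, hdet] at h'
  linarith

lemma CayleySubinvariant.of_orthogonal {n : ℕ} {h : Matrix (Fin n) (Fin n) ℝ}
    (hO : hᵀ * h = 1) (hdet : h.det = 1) : CayleySubinvariant h := by
  obtain ⟨s, hs⟩ := exists_det_signDiagonal_add_ne_zero h
  have hD := signDiagonal_mul_self s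
  have hQ : (signDiagonal s * h)ᵀ * (signDiagonal s * h) = 1 :=
    orthogonal_mul (by rw [transpose_signDiagonal, hD]) hO
  have hne : (1 + signDiagonal s * h).det ≠ 0 := by
    have e : 1 + signDiagonal s * h = signDiagonal s * (signDiagonal s + h) := by
      rw [Matrix.mul_add, hD]
    rw [e, det_mul, det_signDiagonal]
    exact mul_ne_zero (pow_ne_zero _ (by norm_num)) hs
  have hdetQ : (signDiagonal s * h).det = (-1) ^ s.card := by
    rw [det_mul, hdet, mul_one, det_signDiagonal]
  rcases Nat.even_or_odd s.card with he | ho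
  · obtain ⟨k, hk⟩ := he
    have H := (cayleySubinvariant_signDiagonal k s (by omega)).mul
      (cayleySubinvariant_of_det_one_add_ne_zero hQ (by rw [hdetQ, Even.neg_one_pow ⟨k, hk⟩]) hne)
    rwa [← Matrix.mul_assoc, hD, Matrix.one_mul] at H
  · exact absurd (det_one_add_eq_zero_of_det_eq_neg_one hQ (by rw [hdetQ, ho.neg_one_pow])) hne

lemma lintegral_cayleyMeasure_mul {n : ℕ} {h : Matrix (Fin n) (Fin n) ℝ}
    (hO : hᵀ * h = 1) (hdet : h.det = 1) {F : Matrix (Fin n) (Fin n) ℝ → ENNReal}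
    (hF : Measurable F) :
    ∫⁻ P, F (h * P) ∂cayleyMeasure n = ∫⁻ P, F P ∂cayleyMeasure n := by
  have hO' : h * hᵀ = 1 := mul_eq_one_comm.1 hO
  refine le_antisymm (CayleySubinvariant.of_orthogonal hO hdet F hF) ?_
  have H := CayleySubinvariant.of_orthogonal (h := hᵀ) (by rwa [transpose_transpose])
    (by rwa [det_transpose]) (fun P => F (h * P)) (hF.comp (measurable_const.mul measurable_id))
  simpa only [← Matrix.mul_assoc, hO', Matrix.one_mul] using H

/-! ### Uniqueness of Haar measure -/

/-- A measure on matrices that is concentrated on the special orthogonal group and invariant under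
left translation by it. -/
structure IsHaarSO {n : ℕ} (ν : Measure (Matrix (Fin n) (Fin n) ℝ)) : Prop where
  ae_mem : ∀ᵐ P ∂ν, Pᵀ * P = 1 ∧ P.det = 1
  lintegral_mul : ∀ h : Matrix (Fin n) (Fin n) ℝ, hᵀ * h = 1 → h.det = 1 →
    ∀ F : Matrix (Fin n) (Fin n) ℝ → ENNReal, Measurable F → ∫⁻ P, F (h * P) ∂ν = ∫⁻ P, F P ∂ν

lemma measurable_matrix_transpose {n : ℕ} :
    Measurable fun A : Matrix (Fin n) (Fin n) ℝ => Aᵀ :=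
  Continuous.measurable continuous_id.matrix_transpose

lemma isHaarSO_cayleyMeasure (n : ℕ) : IsHaarSO (cayleyMeasure n) where
  ae_mem := by
    have hm : MeasurableSet {P : Matrix (Fin n) (Fin n) ℝ | Pᵀ * P = 1 ∧ P.det = 1} :=
      (measurableSet_eq_fun (measurable_matrix_transpose.mul measurable_id) measurable_const).inter
        (measurableSet_eq_fun measurable_matrix_det measurable_const)
    rw [cayleyMeasure, ae_map_iff measurable_cayley_toSkew.aemeasurable hm]
    exact Filter.Eventually.of_forall fun x =>
      ⟨transpose_cayley_mul_cayley (transpose_toSkew x), det_cayley (transpose_toSkew x)⟩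
  lintegral_mul _ hO hdet _ hF := lintegral_cayleyMeasure_mul hO hdet hF

lemma IsHaarSO.lintegral_eq {n : ℕ} {ν μ : Measure (Matrix (Fin n) (Fin n) ℝ)} [SFinite ν]
    [IsProbabilityMeasure μ] (hν : IsHaarSO ν) (hμ : IsHaarSO μ)
    {F : Matrix (Fin n) (Fin n) ℝ → ENNReal} (hF : Measurable F) :
    ∫⁻ P, F P ∂ν = (∫⁻ P, F Pᵀ ∂μ) * ν Set.univ := by
  have hFT : Measurable fun P => F Pᵀ := hF.comp measurable_matrix_transpose
  have h₁ : (fun P => ∫⁻ h, F (hᵀ * P) ∂μ) =ᵐ[ν] fun _ => ∫⁻ h, F hᵀ ∂μ := by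
    filter_upwards [hν.ae_mem] with P hP
    have hP' : P * Pᵀ = 1 := mul_eq_one_comm.1 hP.1
    rw [← hμ.lintegral_mul Pᵀ (by rwa [transpose_transpose]) (by rw [det_transpose, hP.2]) _ hFT]
    simp only [transpose_mul, transpose_transpose]
  have h₂ : (fun h => ∫⁻ P, F (hᵀ * P) ∂ν) =ᵐ[μ] fun _ => ∫⁻ P, F P ∂ν := by
    filter_upwards [hμ.ae_mem] with h hh
    have hh' : h * hᵀ = 1 := mul_eq_one_comm.1 hh.1
    exact hν.lintegral_mul hᵀ (by rwa [transpose_transpose]) (by rw [det_transpose, hh.2]) _ hF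
  calc ∫⁻ P, F P ∂ν = ∫⁻ h, ∫⁻ P, F (hᵀ * P) ∂ν ∂μ := by
        rw [lintegral_congr_ae h₂, lintegral_const, measure_univ, mul_one]
    _ = ∫⁻ P, ∫⁻ h, F (hᵀ * P) ∂μ ∂ν := by
        refine lintegral_lintegral_swap (Measurable.aemeasurable ?_)
        exact hF.comp ((measurable_matrix_transpose.comp measurable_fst).mul measurable_snd)
    _ = _ := by rw [lintegral_congr_ae h₁, lintegral_const]

lemma IsHaarSO.lintegral_transpose {n : ℕ} {μ : Measure (Matrix (Fin n) (Fin n) ℝ)}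
    [IsProbabilityMeasure μ] (hμ : IsHaarSO μ)
    {F : Matrix (Fin n) (Fin n) ℝ → ENNReal} (hF : Measurable F) :
    ∫⁻ P, F Pᵀ ∂μ = ∫⁻ P, F P ∂μ := by
  rw [hμ.lintegral_eq hμ hF, measure_univ, mul_one]

lemma IsHaarSO.lintegral_mul_right {n : ℕ} {μ : Measure (Matrix (Fin n) (Fin n) ℝ)}
    [IsProbabilityMeasure μ] (hμ : IsHaarSO μ) {M : Matrix (Fin n) (Fin n) ℝ} (hM : Mᵀ * M = 1)
    (hdet : M.det = 1) {F : Matrix (Fin n) (Fin n) ℝ → ENNReal} (hF : Measurable F) :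
    ∫⁻ P, F (P * M) ∂μ = ∫⁻ P, F P ∂μ := by
  have hM' : M * Mᵀ = 1 := mul_eq_one_comm.1 hM
  rw [← hμ.lintegral_transpose (F := fun P => F (P * M))
    (hF.comp (measurable_id.mul measurable_const)), ← hμ.lintegral_transpose hF,
    ← hμ.lintegral_mul Mᵀ (by rwa [transpose_transpose]) (by rwa [det_transpose])
      (fun P => F Pᵀ) (hF.comp measurable_matrix_transpose)]
  simp only [transpose_mul, transpose_transpose]

lemma IsHaarSO.cayleyMeasure_eq {n : ℕ} {μ : Measure (Matrix (Fin n) (Fin n) ℝ)}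
    [IsProbabilityMeasure μ] (hμ : IsHaarSO μ) :
    cayleyMeasure n = cayleyMeasure n Set.univ • μ := by
  refine Measure.ext fun s hs => ?_
  have hF : Measurable (s.indicator (1 : Matrix (Fin n) (Fin n) ℝ → ENNReal)) :=
    measurable_one.indicator hs
  rw [← lintegral_indicator_one hs, (isHaarSO_cayleyMeasure n).lintegral_eq hμ hF,
    hμ.lintegral_transpose hF, lintegral_indicator_one hs, Measure.smul_apply, smul_eq_mul,
    mul_comm]

lemma cayleyDensity_pos {n : ℕ} (x : SkewCoord n) : 0 < cayleyDensity x := by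
  rw [cayleyDensity, ENNReal.ofReal_pos]
  exact inv_pos.2 (pow_pos (abs_pos.2 (det_one_add_ne_zero_of_skew (transpose_toSkew x))) _)

lemma cayleyMeasure_univ_ne_zero (n : ℕ) : cayleyMeasure n Set.univ ≠ 0 := by
  rw [cayleyMeasure, Measure.map_apply measurable_cayley_toSkew MeasurableSet.univ,
    Set.preimage_univ, withDensity_apply _ MeasurableSet.univ, Measure.restrict_univ,
    Ne, lintegral_eq_zero_iff measurable_cayleyDensity]
  intro h
  have h' : ∀ᵐ x : SkewCoord n, False := by
    filter_upwards [h] with x hx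
    exact (cayleyDensity_pos x).ne' hx
  have := h'.exists
  simp at this

lemma IsHaarSO.cayleyMeasure_univ_ne_top {n : ℕ} {μ : Measure (Matrix (Fin n) (Fin n) ℝ)}
    [IsProbabilityMeasure μ] (hμ : IsHaarSO μ) : cayleyMeasure n Set.univ ≠ ⊤ := by
  intro htop
  set K : Set (Matrix (Fin n) (Fin n) ℝ) :=
    (fun P => ofSkew (invCayley P)) ⁻¹' Metric.closedBall 0 1 with hK
  have hKm : MeasurableSet K := by
    have hc : Continuous (ofSkew : Matrix (Fin n) (Fin n) ℝ → SkewCoord n) :=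
      LinearMap.continuous_of_finiteDimensional _
    exact (hc.measurable.comp measurable_invCayley) Metric.isClosed_closedBall.measurableSet
  have hval : cayleyMeasure n K = ∫⁻ x in Metric.closedBall (0 : SkewCoord n) 1,
      cayleyDensity x := by
    have hpre : (fun x : SkewCoord n => cayley (toSkew x)) ⁻¹' K = Metric.closedBall 0 1 := by
      ext x
      simp only [hK, Set.mem_preimage, invCayley_cayley (transpose_toSkew x), ofSkew_toSkew]
    rw [cayleyMeasure, Measure.map_apply measurable_cayley_toSkew hKm, hpre,
      withDensity_apply _ Metric.isClosed_closedBall.measurableSet]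
  have hfin : cayleyMeasure n K ≠ ⊤ := by
    rw [hval]
    exact (setLIntegral_lt_top_of_isCompact measure_closedBall_lt_top.ne
      (isCompact_closedBall (0 : SkewCoord n) 1)
      (continuous_real_toNNReal.comp continuous_cayleyDensity_toReal)).ne
  have hpos : cayleyMeasure n K ≠ 0 := by
    rw [hval, Ne, lintegral_eq_zero_iff measurable_cayleyDensity]
    intro h
    have hvol : volume (Metric.closedBall (0 : SkewCoord n) 1) = 0 := by
      rw [← Measure.restrict_eq_zero, ← ae_eq_bot, ← Filter.eventually_false_iff_eq_bot]
      filter_upwards [h] with x hx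
      exact (cayleyDensity_pos x).ne' hx
    exact (Metric.measure_closedBall_pos volume (0 : SkewCoord n) one_pos).ne' hvol
  rw [hμ.cayleyMeasure_eq, htop, Measure.smul_apply, smul_eq_mul] at hfin hpos
  exact hfin (ENNReal.top_mul (right_ne_zero_of_mul hpos))

/-! ### The scaled Cayley transform -/

/-- The density of the pushforward of Haar measure under the scaled Cayley transform. -/
noncomputable def pushforwardDensity {n : ℕ} (M : Matrix (Fin n) (Fin n) ℝ) (κ : ℝ)
    (P : Matrix (Fin n) (Fin n) ℝ) : ℝ :=
  (1 - κ ^ 2) ^ (n * (n - 1) / 2) /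
    (P * Mᵀ - κ • (1 : Matrix (Fin n) (Fin n) ℝ)).det ^ (n - 1)

lemma measurable_pushforwardDensity {n : ℕ} (M : Matrix (Fin n) (Fin n) ℝ) (κ : ℝ) :
    Measurable (pushforwardDensity M κ) :=
  measurable_const.div ((measurable_matrix_det.comp
    ((measurable_id.mul measurable_const).sub measurable_const)).pow_const _)

lemma det_cayley_sub_smul_one {n : ℕ} {A : Matrix (Fin n) (Fin n) ℝ} (hA : Aᵀ = -A) {κ : ℝ}
    (hκ1 : κ < 1) :
    (cayley A - κ • (1 : Matrix (Fin n) (Fin n) ℝ)).det * (1 + A).det =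
      (1 - κ) ^ n * (1 + ((1 + κ) / (1 - κ)) • A).det := by
  have h : (1 - A)⁻¹ * (1 - A) = 1 :=
    nonsing_inv_mul _ (det_one_sub_ne_zero_of_skew hA).isUnit
  have hκ : 1 - κ ≠ 0 := by linarith
  have e : (cayley A - κ • (1 : Matrix (Fin n) (Fin n) ℝ)) * (1 - A) =
      (1 - κ) • (1 + ((1 + κ) / (1 - κ)) • A) := by
    rw [cayley_eq_mul_inv hA, Matrix.sub_mul, Matrix.mul_assoc, h, Matrix.mul_one, smul_add,
      smul_smul, mul_div_cancel₀ _ hκ, Matrix.smul_mul, Matrix.one_mul]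
    module
  rw [det_one_add_eq_det_one_sub_of_skew hA, ← det_mul, e, det_smul, Fintype.card_fin]

lemma cayleyDensity_smul {n : ℕ} {M : Matrix (Fin n) (Fin n) ℝ} (hM : Mᵀ * M = 1) {κ : ℝ}
    (hκ0 : 0 ≤ κ) (hκ1 : κ < 1) (x : SkewCoord n) :
    ENNReal.ofReal (((1 + κ) / (1 - κ)) ^ (n * (n - 1) / 2)) *
        cayleyDensity (((1 + κ) / (1 - κ)) • x) =
      cayleyDensity x * ENNReal.ofReal (pushforwardDensity M κ (cayley (toSkew x) * M)) := by
  have hAs := transpose_toSkew x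
  have hM' : M * Mᵀ = 1 := mul_eq_one_comm.1 hM
  have hpos : 0 < (cayley (toSkew x) - κ • (1 : Matrix (Fin n) (Fin n) ℝ)).det :=
    det_sub_smul_one_pos (transpose_cayley_mul_cayley hAs) (det_cayley hAs) hκ0 hκ1
  have hdet := congrArg (fun t => |t| ^ (n - 1)) (det_cayley_sub_smul_one hAs hκ1)
  have hκ : 0 < 1 - κ := by linarith
  have hγ : 0 < (1 + κ) / (1 - κ) := by positivity
  have h₁ : |(1 + toSkew x).det| ^ (n - 1) ≠ 0 :=
    pow_ne_zero _ (abs_ne_zero.2 (det_one_add_ne_zero_of_skew hAs))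
  have h₂ : |(1 + ((1 + κ) / (1 - κ)) • toSkew x).det| ^ (n - 1) ≠ 0 := by
    rw [← map_smul]
    exact pow_ne_zero _ (abs_ne_zero.2 (det_one_add_ne_zero_of_skew (transpose_toSkew _)))
  simp only [abs_mul, abs_pow, mul_pow, abs_of_pos hpos, abs_of_pos hκ, ← pow_mul] at hdet
  have hd : 2 * (n * (n - 1) / 2) = n * (n - 1) :=
    Nat.two_mul_div_two_of_even (Nat.even_mul_pred_self n)
  rw [cayleyDensity, cayleyDensity, ← ENNReal.ofReal_mul (by positivity),
    ← ENNReal.ofReal_mul (by positivity), pushforwardDensity, Matrix.mul_assoc, hM',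
    Matrix.mul_one, map_smul]
  congr 1
  have h₃ := pow_ne_zero (n - 1) hpos.ne'
  rw [← hd, pow_mul] at hdet
  have h₄ : ((1 + κ) / (1 - κ)) ^ (n * (n - 1) / 2) * ((1 - κ) ^ 2) ^ (n * (n - 1) / 2) =
      (1 - κ ^ 2) ^ (n * (n - 1) / 2) := by
    rw [← mul_pow]
    congr 1
    field_simp
    ring
  rw [← h₄, ← div_eq_mul_inv, ← div_eq_inv_mul, div_div, div_eq_div_iff h₂ (mul_ne_zero h₃ h₁),
    hdet]
  ring

lemma lintegral_comp_smul_skewCoord {n : ℕ} {r : ℝ} (hr : 0 < r) {G : SkewCoord n → ENNReal}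
    (hG : Measurable G) :
    ∫⁻ x, G x = ENNReal.ofReal (r ^ (n * (n - 1) / 2)) * ∫⁻ x, G (r • x) := by
  have h := Measure.map_addHaar_smul (volume : Measure (SkewCoord n)) hr.ne'
  rw [finrank_skewCoord] at h
  have hp : 0 < r ^ (n * (n - 1) / 2) := pow_pos hr _
  rw [← lintegral_map hG (measurable_const_smul r), h, lintegral_smul_measure, smul_eq_mul,
    ← mul_assoc, ← ENNReal.ofReal_mul hp.le, abs_of_pos (inv_pos.2 hp), mul_inv_cancel₀ hp.ne',
    ENNReal.ofReal_one, one_mul]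

lemma measurable_cayley_smul_invCayley_mul {n : ℕ} (c : ℝ) (M : Matrix (Fin n) (Fin n) ℝ) :
    Measurable fun P => cayley (c • invCayley P) * M :=
  (measurable_cayley.comp (measurable_invCayley.const_smul c)).mul measurable_const

lemma IsHaarSO.lintegral_cayley_smul_invCayley_mul {n : ℕ}
    {μ : Measure (Matrix (Fin n) (Fin n) ℝ)} [IsProbabilityMeasure μ] (hμ : IsHaarSO μ)
    {M : Matrix (Fin n) (Fin n) ℝ} (hM : Mᵀ * M = 1) (hMdet : M.det = 1) {κ : ℝ}
    (hκ0 : 0 ≤ κ) (hκ1 : κ < 1) {F : Matrix (Fin n) (Fin n) ℝ → ENNReal} (hF : Measurable F) :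
    ∫⁻ P, F (cayley (((1 + κ) / (1 - κ))⁻¹ • invCayley P) * M) ∂μ =
      ∫⁻ P, ENNReal.ofReal (pushforwardDensity M κ P) * F P ∂μ := by
  set γ := (1 + κ) / (1 - κ) with hγdef
  have hγ : 0 < γ := by
    have : 0 < 1 - κ := by linarith
    positivity
  have hFT : Measurable fun P => F (cayley (γ⁻¹ • invCayley P) * M) :=
    hF.comp (measurable_cayley_smul_invCayley_mul γ⁻¹ M)
  have hfF : Measurable fun P => ENNReal.ofReal (pushforwardDensity M κ P) * F P :=
    (measurable_pushforwardDensity M κ).ennreal_ofReal.mul hF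
  have hfFM : Measurable fun P =>
      ENNReal.ofReal (pushforwardDensity M κ (P * M)) * F (P * M) :=
    hfF.comp (measurable_id.mul measurable_const)
  have hν : ∀ G : Matrix (Fin n) (Fin n) ℝ → ENNReal,
      ∫⁻ P, G P ∂cayleyMeasure n = cayleyMeasure n Set.univ * ∫⁻ P, G P ∂μ := fun G => by
    conv_lhs => rw [hμ.cayleyMeasure_eq]
    rw [lintegral_smul_measure, smul_eq_mul]
  rw [← hμ.lintegral_mul_right hM hMdet hfF,
    ← ENNReal.mul_right_inj (cayleyMeasure_univ_ne_zero n) hμ.cayleyMeasure_univ_ne_top,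
    ← hν, ← hν, lintegral_cayleyMeasure hFT, lintegral_cayleyMeasure hfFM]
  have hG : Measurable fun x : SkewCoord n =>
      cayleyDensity x * F (cayley (γ⁻¹ • invCayley (cayley (toSkew x))) * M) :=
    measurable_cayleyDensity.mul (hFT.comp measurable_cayley_toSkew)
  rw [lintegral_comp_smul_skewCoord hγ hG, ← lintegral_const_mul' _ _ ENNReal.ofReal_ne_top]
  refine lintegral_congr fun x => ?_
  rw [← mul_assoc, ← mul_assoc, cayleyDensity_smul hM hκ0 hκ1,
    invCayley_cayley (transpose_toSkew _), map_smul, smul_smul, inv_mul_cancel₀ hγ.ne', one_smul]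

lemma IsHaarSO.map_cayley_smul_invCayley_mul {n : ℕ}
    {μ : Measure (Matrix (Fin n) (Fin n) ℝ)} [IsProbabilityMeasure μ] (hμ : IsHaarSO μ)
    {M : Matrix (Fin n) (Fin n) ℝ} (hM : Mᵀ * M = 1) (hMdet : M.det = 1) {κ : ℝ}
    (hκ0 : 0 ≤ κ) (hκ1 : κ < 1) :
    μ.map (fun P => cayley (((1 + κ) / (1 - κ))⁻¹ • invCayley P) * M) =
      μ.withDensity fun P => ENNReal.ofReal (pushforwardDensity M κ P) := by
  refine Measure.ext_of_lintegral _ fun F hF => ?_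
  rw [lintegral_map hF (measurable_cayley_smul_invCayley_mul _ M), hμ.lintegral_cayley_smul_invCayley_mul hM hMdet hκ0 hκ1 hF,
    lintegral_withDensity_eq_lintegral_mul _
      (measurable_pushforwardDensity M κ).ennreal_ofReal hF]
  rfl

/-- Fix `n ≥ 1`, `M ∈ SO(n)`, `κ ∈ [0, 1)`, and set `γ = (1+κ)/(1-κ)`. Let `μ` be the Haar
probability measure on `SO(n)` (encoded as a Borel probability measure on matrices
supported on `SO(n)` and invariant under left translation by `SO(n)`), and define
`T(P) = C(γ⁻¹ (P - I)(I + P)⁻¹) M`. Then for every bounded measurable `g`,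
`∫ g(T P) dμ(P) = ∫ g(P) (1 - κ²)^{n(n-1)/2} det (P Mᵀ - κ I)^{-(n-1)} dμ(P)`;
i.e. the pushforward of `μ` under `T` has density
`f_n(P; M, κ) = (1 - κ²)^{n(n-1)/2} det (P Mᵀ - κ I)^{-(n-1)}` with respect to `μ`. -/
theorem cayley_pushforward_density (n : ℕ) (hn : 1 ≤ n)
    (M : Matrix (Fin n) (Fin n) ℝ) (hM : Mᵀ * M = 1) (hMdet : M.det = 1)
    (κ : ℝ) (hκ0 : 0 ≤ κ) (hκ1 : κ < 1) (γ : ℝ) (hγ : γ = (1 + κ) / (1 - κ))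
    (μ : Measure (Matrix (Fin n) (Fin n) ℝ)) [IsProbabilityMeasure μ]
    (hsupp : μ {P | ¬(Pᵀ * P = 1 ∧ P.det = 1)} = 0)
    (hinv : ∀ h : Matrix (Fin n) (Fin n) ℝ, hᵀ * h = 1 → h.det = 1 →
      Measure.map (fun P => h * P) μ = μ)
    (T : Matrix (Fin n) (Fin n) ℝ → Matrix (Fin n) (Fin n) ℝ)
    (hT : ∀ P, T P = cayley (γ⁻¹ • invCayley P) * M)
    (g : Matrix (Fin n) (Fin n) ℝ → ℝ) (hg : Measurable g)
    (hgbdd : ∃ C : ℝ, ∀ P, |g P| ≤ C) :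
    ∫ P, g (T P) ∂μ =
      ∫ P, g P * ((1 - κ ^ 2) ^ (n * (n - 1) / 2) /
        (P * Mᵀ - κ • (1 : Matrix (Fin n) (Fin n) ℝ)).det ^ (n - 1)) ∂μ := by
  have hμ : IsHaarSO μ := by
    refine ⟨hsupp, fun h hO hdet F hF => ?_⟩
    have hm : Measurable fun P => h * P := measurable_const.mul measurable_id
    conv_rhs => rw [← hinv h hO hdet, lintegral_map hF hm]
  have hT' : T = fun P => cayley (((1 + κ) / (1 - κ))⁻¹ • invCayley P) * M := by
    funext P
    rw [hT, hγ]
  have hM' : Mᵀᵀ * Mᵀ = 1 := by rw [transpose_transpose, mul_eq_one_comm.1 hM]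
  rw [hT', ← integral_map (f := g) (measurable_cayley_smul_invCayley_mul _ M).aemeasurable hg.aestronglyMeasurable,
    hμ.map_cayley_smul_invCayley_mul hM hMdet hκ0 hκ1,
    integral_withDensity_eq_integral_toReal_smul
      (measurable_pushforwardDensity M κ).ennreal_ofReal
      (Filter.Eventually.of_forall fun _ => ENNReal.ofReal_lt_top)]
  refine integral_congr_ae ?_
  filter_upwards [hμ.ae_mem] with P hP
  have hpos : 0 < (P * Mᵀ - κ • (1 : Matrix (Fin n) (Fin n) ℝ)).det :=
    det_sub_smul_one_pos (orthogonal_mul hP.1 hM')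
      (by rw [det_mul, hP.2, det_transpose, hMdet, one_mul]) hκ0 hκ1
  have hnn : 0 ≤ pushforwardDensity M κ P :=
    div_nonneg (pow_nonneg (by nlinarith) _) (pow_nonneg hpos.le _)
  rw [ENNReal.toReal_ofReal hnn, smul_eq_mul, mul_comm, pushforwardDensity]
end

section
/- Fix n ≥ 1, M ∈ SO(n), and κ ∈ [0, 1), and let μ be the Haar probability measure on SO(n). Then ∫_{SO(n)} det(P Mᵀ − κI)^{−(n−1)} dμ(P) = (1 − κ²)^{−n(n−1)/2}; equivalently, the function f_n(P; M, κ) = (1 − κ²)^{n(n−1)/2} det(P Mᵀ − κI)^{−(n−1)} is a probability density with respect to μ. -/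
open Matrix MeasureTheory

open Set Filter Topology

/-- **Jacobi's formula** for the derivative of the determinant along a curve. -/
theorem hasDerivAt_det {m : Type*} [Fintype m] [DecidableEq m] {Γ : ℝ → Matrix m m ℝ}
    {Γ' : Matrix m m ℝ} {t : ℝ} (h : ∀ i j, HasDerivAt (fun u => Γ u i j) (Γ' i j) t) :
    HasDerivAt (fun u => (Γ u).det) ((Γ t).adjugate * Γ').trace t := by
  have key : ((Γ t).adjugate * Γ').trace = ∑ σ : Equiv.Perm m, (Equiv.Perm.sign σ : ℝ) *
      ∑ k, (∏ i ∈ Finset.univ.erase k, Γ t (σ i) i) • Γ' (σ k) k := by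
    have h1 : ((Γ t).adjugate * Γ').trace = ∑ k, ((Γ t).updateCol k (fun i => Γ' i k)).det := by
      refine Finset.sum_congr rfl fun k _ => ?_
      rw [← cramer_apply, cramer_eq_adjugate_mulVec]
      rfl
    simp only [h1, det_apply', Finset.mul_sum]
    rw [Finset.sum_comm]
    refine Finset.sum_congr rfl fun σ _ => Finset.sum_congr rfl fun k _ => ?_
    rw [← Finset.prod_erase_mul _ _ (Finset.mem_univ k), updateCol_self, smul_eq_mul]
    congr 2
    refine Finset.prod_congr rfl fun i hi => ?_
    rw [updateCol_ne (Finset.ne_of_mem_erase hi)]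
  rw [key]
  simp only [det_apply']
  exact HasDerivAt.fun_sum fun σ _ =>
    (HasDerivAt.fun_finsetProd fun k _ => h (σ k) k).const_mul _

/-- Differentiation under the integral sign for a measure carried by a compact set. -/
theorem hasDerivAt_integral_of_isCompact {X : Type*} [TopologicalSpace X] [T2Space X]
    [MeasurableSpace X] [BorelSpace X] {K : Set X} (hK : IsCompact K) {μ : Measure X}
    [IsFiniteMeasure μ] (hμ : ∀ᵐ x ∂μ, x ∈ K) {f f' : ℝ → X → ℝ} {a b t : ℝ}
    (ht : t ∈ Ioo a b) (hf : ∀ u ∈ Icc a b, ContinuousOn (f u) K)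
    (hf' : ContinuousOn (fun p : ℝ × X => f' p.1 p.2) (Icc a b ×ˢ K))
    (hd : ∀ u ∈ Icc a b, ∀ x ∈ K, HasDerivAt (fun v => f v x) (f' u x) u) :
    HasDerivAt (fun u => ∫ x, f u x ∂μ) (∫ x, f' t x ∂μ) t := by
  have hμK : μ.restrict K = μ := Measure.restrict_eq_self_of_ae_mem hμ
  have hint : ∀ {g : X → ℝ}, ContinuousOn g K → Integrable g μ := fun hg => by
    have := hg.integrableOn_compact (μ := μ) hK
    rwa [IntegrableOn, hμK] at this
  obtain ⟨C, hC⟩ := (isCompact_Icc.prod hK).exists_bound_of_continuousOn hf'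
  have htI : t ∈ Icc a b := Ioo_subset_Icc_self ht
  refine (hasDerivAt_integral_of_dominated_loc_of_deriv_le (bound := fun _ => C)
    (Icc_mem_nhds ht.1 ht.2) ?_ (hint (hf t htI)) (F' := f') ?_ ?_ (integrable_const C) ?_).2
  · filter_upwards [Icc_mem_nhds ht.1 ht.2] with u hu
    exact (hint (hf u hu)).aestronglyMeasurable
  · exact (hint (hf'.comp (f := fun x => (t, x)) (by fun_prop)
      fun x hx => ⟨htI, hx⟩)).aestronglyMeasurable
  · filter_upwards [hμ] with x hx u hu using hC (u, x) ⟨hu, hx⟩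
  · filter_upwards [hμ] with x hx u hu using hd u hu x hx

/-- The special orthogonal group, as a set of matrices. -/
def specialOrthogonalSet (n : ℕ) : Set (Matrix (Fin n) (Fin n) ℝ) :=
  {P | Pᵀ * P = 1 ∧ P.det = 1}

theorem isCompact_specialOrthogonalSet (n : ℕ) : IsCompact (specialOrthogonalSet n) := by
  have hbox : IsCompact (univ.pi fun _ : Fin n => univ.pi fun _ : Fin n => Icc (-1 : ℝ) 1) :=
    isCompact_univ_pi fun _ => isCompact_univ_pi fun _ => isCompact_Icc
  refine IsCompact.of_isClosed_subset hbox ?_ ?_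
  · exact (isClosed_eq (by fun_prop) continuous_const).inter
      (isClosed_eq (by fun_prop) continuous_const)
  · rintro P ⟨hP, -⟩ i - j -
    have h := congrFun (congrFun hP j) j
    simp only [mul_apply, transpose_apply, one_apply_eq] at h
    have : P i j * P i j ≤ 1 := h ▸ Finset.single_le_sum
      (f := fun k => P k j * P k j) (fun k _ => mul_self_nonneg _) (Finset.mem_univ i)
    constructor <;> nlinarith

theorem mul_mem_specialOrthogonalSet {n : ℕ} {P Q : Matrix (Fin n) (Fin n) ℝ}
    (hP : P ∈ specialOrthogonalSet n) (hQ : Q ∈ specialOrthogonalSet n) :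
    P * Q ∈ specialOrthogonalSet n := by
  refine ⟨?_, by rw [det_mul, hP.2, hQ.2, one_mul]⟩
  rw [transpose_mul, Matrix.mul_assoc, ← Matrix.mul_assoc Pᵀ, hP.1, Matrix.one_mul, hQ.1]

theorem exp_mem_specialOrthogonalSet {n : ℕ} {A : Matrix (Fin n) (Fin n) ℝ} (hA : Aᵀ = -A) :
    NormedSpace.exp A ∈ specialOrthogonalSet n := by
  have horth : ∀ {B : Matrix (Fin n) (Fin n) ℝ}, Bᵀ = -B →
      (NormedSpace.exp B)ᵀ * NormedSpace.exp B = 1 := fun {B} hB => by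
    rw [← exp_transpose, hB, exp_neg, nonsing_inv_mul]
    exact (isUnit_iff_isUnit_det _).1 (isUnit_exp B)
  refine ⟨horth hA, ?_⟩
  have hhalf : (((1 / 2 : ℝ) • A)ᵀ) = -((1 / 2 : ℝ) • A) := by rw [transpose_smul, hA, smul_neg]
  have h := congrArg det (horth hhalf)
  rw [det_mul, det_transpose, det_one, ← det_mul, ← exp_add_of_commute _ _ (Commute.refl _),
    ← add_smul] at h
  norm_num at h
  exact h

open scoped Matrix.Norms.Operator in
theorem hasDerivAt_exp_smul_mul {n : ℕ} (A P : Matrix (Fin n) (Fin n) ℝ) (i j : Fin n) :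
    HasDerivAt (fun t : ℝ => (NormedSpace.exp (t • A) * P) i j) ((A * P) i j) 0 := by
  have h := (hasDerivAt_exp_smul_const A (0 : ℝ)).mul_const P
  rw [zero_smul, NormedSpace.exp_zero, one_mul] at h
  exact hasDerivAt_pi.1 (hasDerivAt_pi.1 h i) j

open scoped Matrix.Norms.Operator in
theorem continuous_exp_smul {n : ℕ} (A : Matrix (Fin n) (Fin n) ℝ) :
    Continuous fun t : ℝ => NormedSpace.exp (t • A) :=
  NormedSpace.exp_continuous.comp (continuous_id.smul continuous_const)

/-- For a measure on `SO(n)` invariant under left translations, the derivative of a function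
along an infinitesimal rotation has vanishing integral. -/
theorem integral_lieDeriv_eq_zero {n : ℕ} {μ : Measure (Matrix (Fin n) (Fin n) ℝ)}
    [IsProbabilityMeasure μ] (hμ : ∀ᵐ P ∂μ, P ∈ specialOrthogonalSet n)
    (hinv : ∀ h ∈ specialOrthogonalSet n, μ.map (fun P => h * P) = μ)
    {A : Matrix (Fin n) (Fin n) ℝ} (hA : Aᵀ = -A) {g g' : Matrix (Fin n) (Fin n) ℝ → ℝ}
    (hg : ContinuousOn g (specialOrthogonalSet n))
    (hg' : ContinuousOn g' (specialOrthogonalSet n))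
    (hd : ∀ P ∈ specialOrthogonalSet n,
      HasDerivAt (fun t : ℝ => g (NormedSpace.exp (t • A) * P)) (g' P) 0) :
    ∫ P, g' P ∂μ = 0 := by
  have hK := isCompact_specialOrthogonalSet n
  have hexp : ∀ t : ℝ, NormedSpace.exp (t • A) ∈ specialOrthogonalSet n := fun t =>
    exp_mem_specialOrthogonalSet (by rw [transpose_smul, hA, smul_neg])
  have hmeas : AEStronglyMeasurable g μ := by
    have := hg.aestronglyMeasurable_of_isCompact (μ := μ) hK hK.measurableSet
    rwa [Measure.restrict_eq_self_of_ae_mem hμ] at this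
  have hconst : ∀ t : ℝ, ∫ P, g (NormedSpace.exp (t • A) * P) ∂μ = ∫ P, g P ∂μ := fun t => by
    have hm : Measurable fun P => NormedSpace.exp (t • A) * P :=
      (continuous_const.matrix_mul continuous_id).measurable
    have := integral_map (μ := μ) hm.aemeasurable (f := g) (by rwa [hinv _ (hexp t)])
    rw [hinv _ (hexp t)] at this
    exact this.symm
  have hcont : Continuous fun p : ℝ × Matrix (Fin n) (Fin n) ℝ =>
      NormedSpace.exp (p.1 • A) * p.2 :=
    ((continuous_exp_smul A).comp continuous_fst).matrix_mul continuous_snd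
  have hder := hasDerivAt_integral_of_isCompact hK hμ (a := -1) (b := 1) (t := 0)
    (f := fun t P => g (NormedSpace.exp (t • A) * P))
    (f' := fun t P => g' (NormedSpace.exp (t • A) * P)) (by norm_num)
    (fun u _ => hg.comp (continuous_const.matrix_mul continuous_id).continuousOn
      fun P hP => mul_mem_specialOrthogonalSet (hexp u) hP)
    (hg'.comp hcont.continuousOn
      fun p hp => mul_mem_specialOrthogonalSet (hexp p.1) hp.2)
    (fun u _ P hP => by
      have h := hd _ (mul_mem_specialOrthogonalSet (hexp u) hP)
      rw [← sub_self u] at h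
      have h' := h.comp_sub_const u u
      refine h'.congr_of_eventuallyEq (Eventually.of_forall fun v => ?_)
      simp only
      rw [← Matrix.mul_assoc, ← exp_add_of_commute _ _
        (((Commute.refl A).smul_left _).smul_right _), ← add_smul, sub_add_cancel])
  simp only [hconst, zero_smul, NormedSpace.exp_zero, Matrix.one_mul] at hder
  exact hder.unique (hasDerivAt_const _ _)

theorem det_sub_smul_one_ne_zero_s10 {n : ℕ} {P : Matrix (Fin n) (Fin n) ℝ}
    (hP : P ∈ specialOrthogonalSet n) {κ : ℝ} (hκ : κ ∈ Ioo (-1 : ℝ) 1) :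
    (P - κ • (1 : Matrix (Fin n) (Fin n) ℝ)).det ≠ 0 := by
  intro h
  obtain ⟨v, hv, hPv⟩ := exists_mulVec_eq_zero_iff.2 h
  rw [sub_mulVec, smul_mulVec, one_mulVec, sub_eq_zero] at hPv
  have hnorm : (P *ᵥ v) ⬝ᵥ (P *ᵥ v) = v ⬝ᵥ v := by
    rw [dotProduct_mulVec, vecMul_mulVec, ← dotProduct_mulVec, hP.1, one_mulVec]
  rw [hPv, smul_dotProduct, dotProduct_smul, smul_eq_mul, smul_eq_mul] at hnorm
  have hvv : v ⬝ᵥ v ≠ 0 := fun h0 => hv (dotProduct_self_eq_zero.1 h0)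
  have : κ * κ = 1 := mul_right_cancel₀ hvv (by linarith)
  nlinarith [hκ.1, hκ.2]

theorem continuousOn_inv_sub_smul_one (n : ℕ) :
    ContinuousOn (fun p : ℝ × Matrix (Fin n) (Fin n) ℝ =>
      (p.2 - p.1 • (1 : Matrix (Fin n) (Fin n) ℝ))⁻¹)
      (Ioo (-1) 1 ×ˢ specialOrthogonalSet n) := by
  simp only [inv_def, Ring.inverse_eq_inv']
  exact (ContinuousOn.inv₀ (by fun_prop) fun p hp => det_sub_smul_one_ne_zero_s10 hp.2 hp.1).smul
    (by fun_prop)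

theorem continuousOn_inv_det_pow (n s : ℕ) :
    ContinuousOn (fun p : ℝ × Matrix (Fin n) (Fin n) ℝ =>
      ((p.2 - p.1 • (1 : Matrix (Fin n) (Fin n) ℝ)).det ^ s)⁻¹)
      (Ioo (-1) 1 ×ˢ specialOrthogonalSet n) :=
  ContinuousOn.inv₀ (by fun_prop) fun _ hp => pow_ne_zero _ (det_sub_smul_one_ne_zero_s10 hp.2 hp.1)

theorem continuousOn_inv_sub_smul_one_right {n : ℕ} {κ : ℝ} (hκ : κ ∈ Ioo (-1 : ℝ) 1) :
    ContinuousOn (fun P : Matrix (Fin n) (Fin n) ℝ =>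
      (P - κ • (1 : Matrix (Fin n) (Fin n) ℝ))⁻¹) (specialOrthogonalSet n) :=
  (continuousOn_inv_sub_smul_one n).comp
    (f := fun P : Matrix (Fin n) (Fin n) ℝ => (κ, P)) (by fun_prop) fun _ hP => ⟨hκ, hP⟩

theorem continuousOn_inv_det_pow_right {n : ℕ} (s : ℕ) {κ : ℝ} (hκ : κ ∈ Ioo (-1 : ℝ) 1) :
    ContinuousOn (fun P : Matrix (Fin n) (Fin n) ℝ =>
      ((P - κ • (1 : Matrix (Fin n) (Fin n) ℝ)).det ^ s)⁻¹) (specialOrthogonalSet n) :=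
  (continuousOn_inv_det_pow n s).comp
    (f := fun P : Matrix (Fin n) (Fin n) ℝ => (κ, P)) (by fun_prop) fun _ hP => ⟨hκ, hP⟩

theorem hasDerivAt_inv_det_pow {m : Type*} [Fintype m] [DecidableEq m] {Γ : ℝ → Matrix m m ℝ}
    {Γ' : Matrix m m ℝ} {t : ℝ} (h : ∀ i j, HasDerivAt (fun u => Γ u i j) (Γ' i j) t)
    (h0 : (Γ t).det ≠ 0) (s : ℕ) :
    HasDerivAt (fun u => ((Γ u).det ^ s)⁻¹)
      (-(s * ((Γ t)⁻¹ * Γ').trace * ((Γ t).det ^ s)⁻¹)) t := by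
  refine (((hasDerivAt_det h).fun_pow s).fun_inv (pow_ne_zero s h0)).congr_deriv ?_
  rw [inv_def, Ring.inverse_eq_inv', Matrix.smul_mul, trace_smul, smul_eq_mul]
  cases s with
  | zero => simp
  | succ s => simp only [Nat.add_sub_cancel]; field_simp; ring

/-- The infinitesimal rotation in the plane of the coordinates `i` and `j`. -/
def elementarySkew {n : ℕ} (i j : Fin n) : Matrix (Fin n) (Fin n) ℝ :=
  single i j 1 - single j i 1

theorem sum_lieDeriv_eq {n : ℕ} {P : Matrix (Fin n) (Fin n) ℝ}
    (hP : P ∈ specialOrthogonalSet n) {κ : ℝ} (hκ : κ ∈ Ioo (-1 : ℝ) 1) (s ρ : ℝ)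
    (hs : (n : ℝ) = s + 1) {W : Matrix (Fin n) (Fin n) ℝ} (hW : W = (P - κ • 1)⁻¹) :
    ∑ i, ∑ j, (((elementarySkew i j * P) i j -
        (elementarySkew i j * P) j i) * ρ +
      (P i j - P j i) * -(s * (W * (elementarySkew i j * P)).trace * ρ)) =
      2 * ρ * s * ((1 - κ ^ 2) * W.trace - n * κ) := by
  have hunit : IsUnit (P - κ • (1 : Matrix (Fin n) (Fin n) ℝ)).det :=
    (det_sub_smul_one_ne_zero_s10 hP hκ).isUnit
  have h1 : P * W = 1 + κ • W := by
    have := mul_nonsing_inv _ hunit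
    rw [← hW, Matrix.sub_mul, Matrix.smul_mul, Matrix.one_mul] at this
    rw [← this]; abel
  have h2 : κ • (W * Pᵀ) = W - Pᵀ := by
    have hPP : P * Pᵀ = 1 := mul_eq_one_comm.1 hP.1
    have := nonsing_inv_mul _ hunit
    rw [← hW] at this
    have := congrArg (· * Pᵀ) this
    simp only [Matrix.mul_sub, Matrix.sub_mul, Matrix.mul_assoc, hPP, Matrix.mul_one,
      Matrix.mul_smul, Matrix.smul_mul, Matrix.one_mul] at this
    exact eq_sub_of_add_eq (by rw [add_comm]; exact (sub_eq_iff_eq_add.1 this).symm)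
  have hAP : ∀ i j, (elementarySkew i j * P) i j -
      (elementarySkew i j * P) j i =
      P i i + P j j - 2 * if i = j then P i i else 0 := fun i j => by
    by_cases hij : i = j
    · subst hij; simp [elementarySkew]; ring
    · simp [elementarySkew, Matrix.sub_mul, hij, Ne.symm hij, single_mul_apply_of_ne]; ring
  have htr : ∀ i j, (W * (elementarySkew i j * P)).trace = κ * (W j i - W i j) :=
    fun i j => by
    rw [trace_mul_comm, Matrix.mul_assoc, h1, elementarySkew, Matrix.sub_mul, trace_sub,
      trace_single_mul, trace_single_mul]
    simp [one_apply, eq_comm]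
    ring
  simp only [hAP, htr]
  have e1 : ∑ i, ∑ j, (P i i + P j j - 2 * if i = j then P i i else 0) = 2 * s * P.trace := by
    simp [Finset.sum_add_distrib, Finset.sum_sub_distrib, ← Finset.mul_sum, trace, hs]
    ring
  have e2 : ∑ i, ∑ j, (P i j - P j i) * (W j i - W i j) =
      2 * (P * W).trace - 2 * (W * Pᵀ).trace := by
    have c1 : (P * W).trace = ∑ i, ∑ j, P i j * W j i := rfl
    have c1' : (P * W).trace = ∑ i, ∑ j, P j i * W i j := by rw [c1, Finset.sum_comm]
    have c2 : (W * Pᵀ).trace = ∑ i, ∑ j, P i j * W i j := by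
      simp [trace, mul_apply, mul_comm]
    have c2' : (W * Pᵀ).trace = ∑ i, ∑ j, P j i * W j i := by rw [c2, Finset.sum_comm]
    rw [two_mul, two_mul]
    nth_rewrite 1 [c1]
    nth_rewrite 1 [c2]
    rw [c1', c2']
    simp only [← Finset.sum_add_distrib, ← Finset.sum_sub_distrib]
    exact Finset.sum_congr rfl fun i _ => Finset.sum_congr rfl fun j _ => by ring
  have t1 : (P * W).trace = n + κ * W.trace := by
    rw [h1, trace_add, trace_one, trace_smul, Fintype.card_fin, smul_eq_mul]
  have t2 : κ * (W * Pᵀ).trace = W.trace - P.trace := by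
    rw [← smul_eq_mul, ← trace_smul, h2, trace_sub, trace_transpose]
  calc _ = ρ * ∑ i, ∑ j, (P i i + P j j - 2 * if i = j then P i i else 0) -
        s * κ * ρ * ∑ i, ∑ j, (P i j - P j i) * (W j i - W i j) := by
        simp only [Finset.mul_sum, ← Finset.sum_sub_distrib]
        exact Finset.sum_congr rfl fun i _ => Finset.sum_congr rfl fun j _ => by ring
    _ = _ := by
        rw [e1, e2, t1]
        linear_combination 2 * s * ρ * t2

/-- The differential equation in `κ` satisfied by the integrals of `det (P - κ) ^ (-(n - 1))`,
in integrated form. -/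
theorem integral_inv_det_pow_identity {n : ℕ} (hn : 1 ≤ n)
    {μ : Measure (Matrix (Fin n) (Fin n) ℝ)}
    [IsProbabilityMeasure μ] (hμ : ∀ᵐ P ∂μ, P ∈ specialOrthogonalSet n)
    (hinv : ∀ h ∈ specialOrthogonalSet n, μ.map (fun P => h * P) = μ)
    {κ : ℝ} (hκ : κ ∈ Ioo (-1 : ℝ) 1) :
    (1 - κ ^ 2) * ∫ P, (n - 1 : ℕ) * (P - κ • (1 : Matrix (Fin n) (Fin n) ℝ))⁻¹.trace *
        ((P - κ • (1 : Matrix (Fin n) (Fin n) ℝ)).det ^ (n - 1))⁻¹ ∂μ =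
      n * (n - 1 : ℕ) * κ *
        ∫ P, ((P - κ • (1 : Matrix (Fin n) (Fin n) ℝ)).det ^ (n - 1))⁻¹ ∂μ := by
  set ρ : Matrix (Fin n) (Fin n) ℝ → ℝ := fun P => ((P - κ • 1).det ^ (n - 1))⁻¹ with hρ
  set W : Matrix (Fin n) (Fin n) ℝ → Matrix (Fin n) (Fin n) ℝ := fun P => (P - κ • 1)⁻¹ with hW
  have hK := isCompact_specialOrthogonalSet n
  have hint : ∀ {g : Matrix (Fin n) (Fin n) ℝ → ℝ},
      ContinuousOn g (specialOrthogonalSet n) → Integrable g μ := fun hg => by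
    have := hg.integrableOn_compact (μ := μ) hK
    rwa [IntegrableOn, Measure.restrict_eq_self_of_ae_mem hμ] at this
  have hρc : ContinuousOn ρ (specialOrthogonalSet n) := continuousOn_inv_det_pow_right (n - 1) hκ
  have hWc : ContinuousOn W (specialOrthogonalSet n) := continuousOn_inv_sub_smul_one_right hκ
  have htrc : ∀ {B : Matrix (Fin n) (Fin n) ℝ → Matrix (Fin n) (Fin n) ℝ}, Continuous B →
      ContinuousOn (fun P => (W P * B P).trace) (specialOrthogonalSet n) := fun hB =>
    (continuous_id.matrix_trace (n := Fin n) (R := ℝ)).comp_continuousOn (hWc.mul hB.continuousOn)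
  set G : Fin n → Fin n → Matrix (Fin n) (Fin n) ℝ → ℝ := fun i j P =>
    ((elementarySkew i j * P) i j -
        (elementarySkew i j * P) j i) * ρ P +
      (P i j - P j i) *
        -((n - 1 : ℕ) * (W P * (elementarySkew i j * P)).trace * ρ P) with hG
  have hGc : ∀ i j, ContinuousOn (G i j) (specialOrthogonalSet n) := fun i j =>
    (ContinuousOn.mul (by fun_prop) hρc).add (ContinuousOn.mul (by fun_prop)
      ((continuousOn_const.mul (htrc (by fun_prop))).mul hρc).neg)
  have hG0 : ∀ i j, ∫ P, G i j P ∂μ = 0 := fun i j => by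
    refine integral_lieDeriv_eq_zero hμ hinv (A := elementarySkew i j)
      (by simp [elementarySkew]) (g' := G i j) (g := fun P => (P i j - P j i) * ρ P)
      (ContinuousOn.mul (by fun_prop) hρc) (hGc i j) fun P hP => ?_
    have hent := hasDerivAt_exp_smul_mul (elementarySkew i j) P
    have hdet := hasDerivAt_inv_det_pow
      (Γ := fun t : ℝ => NormedSpace.exp (t • elementarySkew i j) * P - κ • 1)
      (t := 0) (fun k l => (hent k l).sub_const _)
      (by simpa using det_sub_smul_one_ne_zero_s10 hP hκ) (n - 1)
    exact (((hent i j).fun_sub (hent j i)).fun_mul hdet).congr_deriv (by simp [hG, hρ, hW])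
  have hsum : ∫ P, ∑ i, ∑ j, G i j P ∂μ = 0 := by
    rw [integral_finsetSum _ fun i _ => integrable_finsetSum _ fun j _ => hint (hGc i j)]
    refine Finset.sum_eq_zero fun i _ => ?_
    rw [integral_finsetSum _ fun j _ => hint (hGc i j)]
    exact Finset.sum_eq_zero fun j _ => hG0 i j
  have hpt : ∫ P, ∑ i, ∑ j, G i j P ∂μ =
      ∫ P, (2 * (1 - κ ^ 2) * ((n - 1 : ℕ) * (W P).trace * ρ P) -
        2 * (n * (n - 1 : ℕ) * κ) * ρ P) ∂μ := by
    refine integral_congr_ae ?_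
    filter_upwards [hμ] with P hP
    rw [hG, sum_lieDeriv_eq hP hκ (n - 1 : ℕ) (ρ P) (by norm_cast; omega) rfl]
    ring
  have htr1 : ContinuousOn (fun P => (W P).trace) (specialOrthogonalSet n) := by
    simpa using htrc (B := fun _ => 1) continuous_const
  have hint1 : Integrable (fun P => (n - 1 : ℕ) * (W P).trace * ρ P) μ :=
    hint ((continuousOn_const.mul htr1).mul hρc)
  rw [hsum, integral_sub (hint1.const_mul _) ((hint hρc).const_mul _), integral_const_mul,
    integral_const_mul] at hpt
  linarith

theorem hasDerivAt_integral_inv_det_pow {n : ℕ} (s : ℕ) {μ : Measure (Matrix (Fin n) (Fin n) ℝ)}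
    [IsProbabilityMeasure μ] (hμ : ∀ᵐ P ∂μ, P ∈ specialOrthogonalSet n)
    {κ : ℝ} (hκ : κ ∈ Ioo (-1 : ℝ) 1) :
    HasDerivAt (fun κ : ℝ => ∫ P, ((P - κ • (1 : Matrix (Fin n) (Fin n) ℝ)).det ^ s)⁻¹ ∂μ)
      (∫ P, s * (P - κ • (1 : Matrix (Fin n) (Fin n) ℝ))⁻¹.trace *
        ((P - κ • (1 : Matrix (Fin n) (Fin n) ℝ)).det ^ s)⁻¹ ∂μ) κ := by
  obtain ⟨a, ha, haκ⟩ := exists_between hκ.1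
  obtain ⟨b, hκb, hb⟩ := exists_between hκ.2
  have hsub : Icc a b ⊆ Ioo (-1 : ℝ) 1 := Icc_subset_Ioo ha hb
  have hprod : Icc a b ×ˢ specialOrthogonalSet n ⊆ Ioo (-1 : ℝ) 1 ×ˢ specialOrthogonalSet n :=
    prod_mono hsub subset_rfl
  refine hasDerivAt_integral_of_isCompact (isCompact_specialOrthogonalSet n) hμ
    (f := fun κ P => ((P - κ • (1 : Matrix (Fin n) (Fin n) ℝ)).det ^ s)⁻¹)
    (f' := fun κ P => s * (P - κ • (1 : Matrix (Fin n) (Fin n) ℝ))⁻¹.trace *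
        ((P - κ • (1 : Matrix (Fin n) (Fin n) ℝ)).det ^ s)⁻¹) ⟨haκ, hκb⟩ ?_ ?_ ?_
  · exact fun u hu => continuousOn_inv_det_pow_right s (hsub hu)
  · have htr : Continuous fun Q : Matrix (Fin n) (Fin n) ℝ => Q.trace := by fun_prop
    exact (continuousOn_const.mul (htr.comp_continuousOn
      ((continuousOn_inv_sub_smul_one n).mono hprod))).mul
      ((continuousOn_inv_det_pow n s).mono hprod)
  · intro u hu P hP
    have h := hasDerivAt_inv_det_pow (Γ := fun v : ℝ => P - v • (1 : Matrix (Fin n) (Fin n) ℝ))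
      (Γ' := -1) (t := u)
      (fun i j => by
        simpa using ((hasDerivAt_id u).mul_const ((1 : Matrix (Fin n) (Fin n) ℝ) i j)).const_sub
          (P i j))
      (det_sub_smul_one_ne_zero_s10 hP (hsub hu)) s
    simpa using h

theorem integral_inv_det_pow {n : ℕ} (hn : 1 ≤ n) {μ : Measure (Matrix (Fin n) (Fin n) ℝ)}
    [IsProbabilityMeasure μ] (hμ : ∀ᵐ P ∂μ, P ∈ specialOrthogonalSet n)
    (hinv : ∀ h ∈ specialOrthogonalSet n, μ.map (fun P => h * P) = μ)
    {κ : ℝ} (hκ : κ ∈ Ioo (-1 : ℝ) 1) :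
    ∫ P, ((P - κ • (1 : Matrix (Fin n) (Fin n) ℝ)).det ^ (n - 1))⁻¹ ∂μ =
      ((1 - κ ^ 2) ^ (n * (n - 1) / 2))⁻¹ := by
  set F : ℝ → ℝ := fun κ =>
    ∫ P, ((P - κ • (1 : Matrix (Fin n) (Fin n) ℝ)).det ^ (n - 1))⁻¹ ∂μ with hF
  set N := n * (n - 1) / 2 with hN
  have h2N : (2 * N : ℝ) = n * (n - 1 : ℕ) := by
    have : 2 * N = n * (n - 1) := Nat.mul_div_cancel' (Nat.even_mul_pred_self n).two_dvd
    exact_mod_cast this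
  have hder : ∀ u ∈ Ioo (-1 : ℝ) 1,
      HasDerivAt (fun u : ℝ => (1 - u ^ 2) ^ N * F u) 0 u := fun u hu => by
    have h1 : HasDerivAt (fun u : ℝ => 1 - u ^ 2) (-(2 * u)) u := by
      simpa using (hasDerivAt_pow 2 u).const_sub 1
    have hpos : 0 < 1 - u ^ 2 := by nlinarith [hu.1, hu.2]
    have hode := integral_inv_det_pow_identity hn hμ hinv hu
    refine ((h1.fun_pow N).fun_mul
      (hasDerivAt_integral_inv_det_pow (n - 1) hμ hu)).congr_deriv ?_
    refine mul_left_cancel₀ hpos.ne' ?_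
    have hpow : (1 - u ^ 2) * (N * (1 - u ^ 2) ^ (N - 1)) = N * (1 - u ^ 2) ^ N := by
      cases N with
      | zero => simp
      | succ k => rw [Nat.add_sub_cancel, pow_succ]; ring
    linear_combination -(2 * u) * F u * hpow + (1 - u ^ 2) ^ N * hode -
      (1 - u ^ 2) ^ N * u * F u * h2N
  have hzero : F 0 = 1 := by
    have : F 0 = ∫ _, (1 : ℝ) ∂μ := by
      refine integral_congr_ae ?_
      filter_upwards [hμ] with P hP
      simp [hP.2]
    simpa using this
  have hconst := isOpen_Ioo.is_const_of_deriv_eq_zero isPreconnected_Ioo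
    (fun u hu => (hder u hu).differentiableAt.differentiableWithinAt)
    (fun u hu => (hder u hu).deriv) hκ (show (0 : ℝ) ∈ Ioo (-1 : ℝ) 1 by norm_num)
  simp only [hzero] at hconst
  refine eq_inv_of_mul_eq_one_right ?_
  simpa using hconst

/-- Fix `n ≥ 1`, `M ∈ SO(n)`, and `κ ∈ [0, 1)`, and let `μ` be the Haar probability
measure on `SO(n)` (encoded as a Borel probability measure on matrices supported on
`SO(n)` and invariant under left translation by `SO(n)`). Then
`∫ det (P Mᵀ - κ I)^{-(n-1)} dμ(P) = (1 - κ²)^{-n(n-1)/2}`; equivalently,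
`f_n(P; M, κ) = (1 - κ²)^{n(n-1)/2} det (P Mᵀ - κ I)^{-(n-1)}` is a probability density
with respect to `μ`. -/
theorem cayley_density_integrates_to_one (n : ℕ) (hn : 1 ≤ n)
    (M : Matrix (Fin n) (Fin n) ℝ) (hM : Mᵀ * M = 1) (hMdet : M.det = 1)
    (κ : ℝ) (hκ0 : 0 ≤ κ) (hκ1 : κ < 1)
    (μ : Measure (Matrix (Fin n) (Fin n) ℝ)) [IsProbabilityMeasure μ]
    (hsupp : μ {P | ¬(Pᵀ * P = 1 ∧ P.det = 1)} = 0)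
    (hinv : ∀ h : Matrix (Fin n) (Fin n) ℝ, hᵀ * h = 1 → h.det = 1 →
      Measure.map (fun P => h * P) μ = μ) :
    ∫ P, ((P * Mᵀ - κ • (1 : Matrix (Fin n) (Fin n) ℝ)).det ^ (n - 1))⁻¹ ∂μ =
      ((1 - κ ^ 2) ^ (n * (n - 1) / 2))⁻¹ := by
  have hMS : Mᵀ ∈ specialOrthogonalSet n :=
    ⟨by rw [transpose_transpose]; exact mul_eq_one_comm.1 hM, by rw [det_transpose, hMdet]⟩
  have hmem : ∀ᵐ P ∂μ, P ∈ specialOrthogonalSet n := hsupp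
  have hm : Measurable fun P : Matrix (Fin n) (Fin n) ℝ => P * Mᵀ :=
    (continuous_id.matrix_mul continuous_const).measurable
  have hl : ∀ h : Matrix (Fin n) (Fin n) ℝ,
      Measurable fun P : Matrix (Fin n) (Fin n) ℝ => h * P := fun h =>
    (continuous_const.matrix_mul continuous_id).measurable
  have : IsProbabilityMeasure (μ.map fun P => P * Mᵀ) :=
    Measure.isProbabilityMeasure_map hm.aemeasurable
  have hK := isCompact_specialOrthogonalSet n
  have hν : ∀ᵐ P ∂(μ.map fun P => P * Mᵀ), P ∈ specialOrthogonalSet n :=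
    (ae_map_iff hm.aemeasurable hK.measurableSet).2
      (hmem.mono fun P hP => mul_mem_specialOrthogonalSet hP hMS)
  have hνinv : ∀ h ∈ specialOrthogonalSet n,
      (μ.map fun P => P * Mᵀ).map (fun P => h * P) = μ.map fun P => P * Mᵀ := fun h hh => by
    conv_rhs => rw [← hinv h hh.1 hh.2]
    rw [Measure.map_map (hl h) hm, Measure.map_map hm (hl h)]
    congr 1
    funext P
    exact (Matrix.mul_assoc _ _ _).symm
  have hκ : κ ∈ Set.Ioo (-1 : ℝ) 1 := ⟨by linarith, hκ1⟩
  rw [← integral_inv_det_pow hn hν hνinv hκ, integral_map hm.aemeasurable]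
  have := (continuousOn_inv_det_pow_right (n := n) (n - 1) hκ).aestronglyMeasurable_of_isCompact
    (μ := μ.map fun P => P * Mᵀ) hK hK.measurableSet
  rwa [Measure.restrict_eq_self_of_ae_mem hν] at this
end

section
/- Fix M ∈ SO(3), κ ∈ [0, 1), and let μ be the Haar probability measure on the compact group SO(3). Define f(P) = (1 − κ²)³ · det(P Mᵀ − κ I₃)^{−2} for P ∈ SO(3). Then ∫_{SO(3)} f(P) · log f(P) dμ(P) = −log(1 − κ²) − 2 log(1 − κ) − 2κ. Equivalently, the Kullback–Leibler divergence of the Cayley distribution 𝒞₃(M, κ), whose density with respect to μ is f, from the uniform distribution on SO(3) equals −log(1 − κ²) − 2 log(1 − κ) − 2κ. -/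
open Matrix MeasureTheory

section Moments

/-- A continuous function of a bounded random variable is integrable. -/
theorem ContinuousOn.integrable_comp_of_ae_mem_Icc {α : Type*} [MeasurableSpace α]
    {μ : Measure α} [IsFiniteMeasure μ] {X : α → ℝ} {a b : ℝ} {g : ℝ → ℝ}
    (hg : ContinuousOn g (Set.Icc a b)) (hX : AEStronglyMeasurable X μ)
    (hXab : ∀ᵐ x ∂μ, X x ∈ Set.Icc a b) :
    Integrable (fun x => g (X x)) μ := by
  by_cases hab : a ≤ b
  · obtain ⟨C, hC⟩ := isCompact_Icc.exists_bound_of_continuousOn hg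
    refine Integrable.of_bound (C := C) ?_ ?_
    · have hext : Continuous (Set.IccExtend hab (Set.domRestrict (Set.Icc a b) g)) :=
        (continuousOn_iff_continuous_domRestrict.mp hg).Icc_extend'
      refine (hext.comp_aestronglyMeasurable hX).congr ?_
      filter_upwards [hXab] with z hz
      simp [Set.IccExtend_of_mem hab _ hz]
    · filter_upwards [hXab] with z hz using hC _ hz
  · refine (integrable_zero α ℝ μ).congr ?_
    filter_upwards [hXab] with z hz using absurd (hz.1.trans hz.2) hab

/-- Two random variables with values in `[a, b]` and equal moments have equal expectations of
continuous functions. -/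
theorem integral_comp_eq_of_moments_eq {α β : Type*} [MeasurableSpace α] [MeasurableSpace β]
    {μ : Measure α} {ν : Measure β} [IsFiniteMeasure μ] [IsFiniteMeasure ν]
    {X : α → ℝ} {Y : β → ℝ} {a b : ℝ} (hX : AEStronglyMeasurable X μ)
    (hY : AEStronglyMeasurable Y ν) (hXab : ∀ᵐ x ∂μ, X x ∈ Set.Icc a b)
    (hYab : ∀ᵐ y ∂ν, Y y ∈ Set.Icc a b)
    (hmom : ∀ n : ℕ, ∫ x, X x ^ n ∂μ = ∫ y, Y y ^ n ∂ν)
    {g : ℝ → ℝ} (hg : ContinuousOn g (Set.Icc a b)) :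
    ∫ x, g (X x) ∂μ = ∫ y, g (Y y) ∂ν := by
  have hpoly : ∀ p : Polynomial ℝ, ∫ x, p.eval (X x) ∂μ = ∫ y, p.eval (Y y) ∂ν := by
    intro p
    have hmon : ∀ i, ContinuousOn (fun t => p.coeff i * t ^ i) (Set.Icc a b) :=
      fun i => by fun_prop
    simp only [Polynomial.eval_eq_sum_range]
    rw [integral_finsetSum _ fun i _ => (hmon i).integrable_comp_of_ae_mem_Icc hX hXab,
      integral_finsetSum _ fun i _ => (hmon i).integrable_comp_of_ae_mem_Icc hY hYab]
    simp only [integral_const_mul, hmom]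
  refine eq_of_forall_dist_le fun ε hε => ?_
  set K := μ.real Set.univ + ν.real Set.univ + 1 with hK
  have hKpos : 0 < K := by positivity
  obtain ⟨p, hp⟩ := exists_polynomial_near_of_continuousOn a b g hg (ε / K) (by positivity)
  have hpc : ContinuousOn (fun t => p.eval t) (Set.Icc a b) := p.continuous.continuousOn
  have h1 : ‖∫ x, (p.eval (X x) - g (X x)) ∂μ‖ ≤ ε / K * μ.real Set.univ :=
    norm_integral_le_of_norm_le_const (by
      filter_upwards [hXab] with x hx using (hp _ hx).le)
  have h2 : ‖∫ y, (p.eval (Y y) - g (Y y)) ∂ν‖ ≤ ε / K * ν.real Set.univ :=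
    norm_integral_le_of_norm_le_const (by
      filter_upwards [hYab] with y hy using (hp _ hy).le)
  rw [integral_sub (hpc.integrable_comp_of_ae_mem_Icc hX hXab)
    (hg.integrable_comp_of_ae_mem_Icc hX hXab), Real.norm_eq_abs, abs_le] at h1
  rw [integral_sub (hpc.integrable_comp_of_ae_mem_Icc hY hYab)
    (hg.integrable_comp_of_ae_mem_Icc hY hYab), Real.norm_eq_abs, abs_le] at h2
  have h3 : ε / K * μ.real Set.univ + ε / K * ν.real Set.univ ≤ ε := by
    rw [← mul_add, div_mul_eq_mul_div, div_le_iff₀ hKpos]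
    exact mul_le_mul_of_nonneg_left (by linarith) hε.le
  have h4 := hpoly p
  rw [Real.dist_eq, abs_le]
  constructor <;> linarith [h1.1, h1.2, h2.1, h2.2]

/-- The moment recursion of the trace of a Haar distributed rotation determines all moments. -/
theorem eq_of_trace_moment_recursion {m m' : ℕ → ℝ} (h0 : m 0 = m' 0)
    (hm : ∀ n : ℕ, (n + 2 : ℝ) * m (n + 1) = 2 * n * m n + 3 * n * m (n - 1))
    (hm' : ∀ n : ℕ, (n + 2 : ℝ) * m' (n + 1) = 2 * n * m' n + 3 * n * m' (n - 1)) (n : ℕ) :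
    m n = m' n := by
  induction n using Nat.strong_induction_on with
  | _ n ih =>
    cases n with
    | zero => exact h0
    | succ n =>
      have h1 := hm n
      rw [ih n (by omega), ih (n - 1) (by omega), ← hm' n] at h1
      exact mul_left_cancel₀ (by positivity) h1

end Moments

section CircleIntegral

open Complex in
/-- Cauchy's formula for the weight `(1 - cos θ) / |1 - κ e^{iθ}|⁴`. -/
theorem integral_one_sub_cos_div_mul {κ : ℝ} (hκ0 : 0 ≤ κ) (hκ1 : κ < 1) {h : ℂ → ℂ}
    {U : Set ℂ} (hU : IsOpen U) (hUball : Metric.closedBall 0 1 ⊆ U)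
    (hU' : ∀ z ∈ U, 1 - κ * z ≠ 0) (hh : DifferentiableOn ℂ h U) :
    ∫ θ in (0 : ℝ)..2 * Real.pi, (((1 - Real.cos θ) / (1 - 2 * κ * Real.cos θ + κ ^ 2) ^ 2 : ℝ) : ℂ)
        * h (exp (θ * I)) =
      2 * Real.pi * deriv (fun z => -(z - 1) ^ 2 / 2 * h z / (1 - κ * z) ^ 2) κ := by
  set A : ℂ → ℂ := fun z => -(z - 1) ^ 2 / 2 * h z / (1 - κ * z) ^ 2 with hA
  have hAd : DifferentiableOn ℂ A U :=
    DifferentiableOn.div (DifferentiableOn.mul (by fun_prop) hh) (by fun_prop)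
      fun z hz => pow_ne_zero _ (hU' z hz)
  have hmem : (κ : ℂ) ∈ Metric.ball (0 : ℂ) 1 := by
    simpa [abs_of_nonneg hκ0] using hκ1
  rw [← two_pi_I_inv_smul_circleIntegral_sub_sq_inv_smul_of_differentiable hU hUball hAd hmem]
  have hpi : (Real.pi : ℂ) ≠ 0 := by exact_mod_cast Real.pi_ne_zero
  rw [circleIntegral, smul_eq_mul, ← mul_assoc, ← intervalIntegral.integral_const_mul]
  refine intervalIntegral.integral_congr fun θ _ => ?_
  simp only [deriv_circleMap, circleMap_zero, ofReal_one, one_mul, smul_eq_mul]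
  set z := exp (θ * I) with hz
  have hz0 : z ≠ 0 := exp_ne_zero _
  have hzw : exp (-(θ * I)) = z⁻¹ := exp_neg _
  have hcos : ((Real.cos θ : ℝ) : ℂ) = (z + z⁻¹) / 2 := by
    rw [ofReal_cos, Complex.cos, neg_mul, hzw]
  have hn : ‖z‖ = 1 := norm_exp_ofReal_mul_I θ
  have h1 : 1 - κ * z ≠ 0 := hU' z (hUball (by simp [hn]))
  have h2 : z - κ ≠ 0 := by
    intro h
    rw [sub_eq_zero] at h
    rw [h] at hn
    simp [abs_of_nonneg hκ0] at hn
    linarith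
  have hD : 1 - 2 * κ * ((z + z⁻¹) / 2) + (κ : ℂ) ^ 2 = (1 - κ * z) * (z - κ) / z := by
    field_simp
    ring
  have hI := I_ne_zero
  push_cast
  rw [← ofReal_cos, hcos, hD, hA]
  field_simp
  ring

/-- The integral of the Cayley density times its logarithm against the angular density of the
Haar measure on `SO(3)`. -/
theorem integral_one_sub_cos_mul_cayley {κ : ℝ} (hκ0 : 0 ≤ κ) (hκ1 : κ < 1) :
    ∫ θ in (0 : ℝ)..2 * Real.pi, (1 - Real.cos θ) / (2 * Real.pi) *
      ((1 - κ ^ 2) ^ 3 / ((1 - κ) * (1 + κ + κ ^ 2 - κ * (1 + 2 * Real.cos θ))) ^ 2 *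
        Real.log ((1 - κ ^ 2) ^ 3 / ((1 - κ) * (1 + κ + κ ^ 2 - κ * (1 + 2 * Real.cos θ))) ^ 2)) =
      -Real.log (1 - κ ^ 2) - 2 * Real.log (1 - κ) - 2 * κ := by
  set C : ℝ := (1 + κ) ^ 3 * (1 - κ) with hC
  have hκ' : 0 < 1 - κ := by linarith
  have hκ'' : 0 < 1 + κ := by linarith
  have hsq : 0 < 1 - κ ^ 2 := by nlinarith
  have hCpos : 0 < C := by positivity
  set U : Set ℂ := {z | 0 < (1 - κ * z).re} with hUdef
  set h : ℂ → ℂ := fun z => Real.log C - 4 * Complex.log (1 - κ * z) with hh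
  have hre : ∀ z : ℂ, (1 - κ * z).re = 1 - κ * z.re := fun z => by simp
  have hU : IsOpen U := isOpen_lt continuous_const (by fun_prop)
  have hUball : Metric.closedBall 0 1 ⊆ U := by
    intro z hz
    have h1 : z.re ≤ 1 := (Complex.re_le_norm z).trans (by simpa using hz)
    simp only [hUdef, Set.mem_ofPred_eq, hre]
    nlinarith
  have hU' : ∀ z ∈ U, 1 - κ * z ≠ 0 := fun z hz h0 => by
    simp only [hUdef, Set.mem_ofPred_eq, h0, Complex.zero_re, lt_irrefl] at hz
  have hslit : ∀ z ∈ U, 1 - κ * z ∈ Complex.slitPlane := fun z hz => Or.inl hz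
  have hhd : DifferentiableOn ℂ h U := by
    intro z hz
    have h1 : DifferentiableAt ℂ (fun z : ℂ => Complex.log (1 - κ * z)) z :=
      DifferentiableAt.clog (by fun_prop) (hslit z hz)
    exact ((h1.const_mul 4).const_sub _).differentiableWithinAt
  have key := integral_one_sub_cos_div_mul hκ0 hκ1 hU hUball hU' hhd
  have hκU : (κ : ℂ) ∈ U := by
    simp only [hUdef, Set.mem_ofPred_eq, hre, Complex.ofReal_re]
    nlinarith
  have hderiv : HasDerivAt (fun z : ℂ => -(z - 1) ^ 2 / 2 * h z / (1 - κ * z) ^ 2)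
      (((-Real.log (1 - κ ^ 2) - 2 * Real.log (1 - κ) - 2 * κ) / C : ℝ) : ℂ) κ := by
    have hL : HasDerivAt h (-(4 * ((-κ : ℂ) / (1 - κ * κ)))) (κ : ℂ) := by
      have h1 : HasDerivAt (fun z : ℂ => 1 - κ * z) (-(κ : ℂ)) κ := by
        simpa using ((hasDerivAt_id (κ : ℂ)).const_mul (κ : ℂ)).const_sub 1
      simpa [hh] using ((h1.clog (hslit _ hκU)).const_mul 4).const_sub ((Real.log C : ℝ) : ℂ)
    have hN : HasDerivAt (fun z : ℂ => -(z - 1) ^ 2 / 2) (-(κ - 1 : ℂ)) (κ : ℂ) := by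
      refine (((((hasDerivAt_id (κ : ℂ)).sub_const 1).fun_pow 2).fun_neg).div_const 2).congr_deriv ?_
      simp only [id]
      push_cast
      ring
    have hDen : HasDerivAt (fun z : ℂ => (1 - κ * z) ^ 2) (2 * (1 - κ * κ) * (-κ : ℂ)) (κ : ℂ) := by
      have h1 : HasDerivAt (fun z : ℂ => 1 - κ * z) (-(κ : ℂ)) κ := by
        simpa using ((hasDerivAt_id (κ : ℂ)).const_mul (κ : ℂ)).const_sub 1
      simpa using h1.fun_pow 2
    refine ((hN.fun_mul hL).div hDen (pow_ne_zero _ (hU' _ hκU))).congr_deriv ?_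
    have hlog : Complex.log (1 - κ * κ) = ((Real.log (1 - κ ^ 2) : ℝ) : ℂ) := by
      rw [Complex.ofReal_log hsq.le]; push_cast; ring_nf
    have hlogsq : Real.log (1 - κ ^ 2) = Real.log (1 + κ) + Real.log (1 - κ) := by
      rw [← Real.log_mul hκ''.ne' hκ'.ne']; ring_nf
    have hlogC : Real.log C = 3 * Real.log (1 + κ) + Real.log (1 - κ) := by
      rw [hC, Real.log_mul (by positivity) hκ'.ne', Real.log_pow]; norm_num
    simp only [hh, hlog, hlogC, hlogsq]
    norm_cast
    have e : 1 - κ * κ = (1 + κ) * (1 - κ) := by ring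
    rw [e, hC]
    field_simp
    ring
  rw [hderiv.deriv] at key
  have hDpos : ∀ θ : ℝ, 0 < 1 - 2 * κ * Real.cos θ + κ ^ 2 := fun θ => by
    nlinarith [Real.cos_le_one θ, mul_pos hκ' hκ']
  have hexpU : ∀ θ : ℝ, Complex.exp (θ * Complex.I) ∈ U := fun θ =>
    hUball (by simp [Complex.norm_exp_ofReal_mul_I])
  have hcont : Continuous fun θ : ℝ =>
      (((1 - Real.cos θ) / (1 - 2 * κ * Real.cos θ + κ ^ 2) ^ 2 : ℝ) : ℂ) *
        h (Complex.exp (θ * Complex.I)) := by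
    refine Continuous.mul (Complex.continuous_ofReal.comp ?_) ?_
    · exact Continuous.div (by fun_prop) (by fun_prop) fun θ => pow_ne_zero _ (hDpos θ).ne'
    · exact hhd.continuousOn.comp_continuous (by fun_prop) hexpU
  have keyre := congrArg Complex.re key
  rw [← Complex.reCLM_apply, ← ContinuousLinearMap.intervalIntegral_comp_comm _
    (hcont.intervalIntegrable _ _)] at keyre
  simp only [Complex.reCLM_apply, Complex.re_ofReal_mul] at keyre
  have hrhs : (2 * (Real.pi : ℂ) * (((-Real.log (1 - κ ^ 2) - 2 * Real.log (1 - κ) - 2 * κ) / C : ℝ)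
      : ℂ)).re = 2 * Real.pi * ((-Real.log (1 - κ ^ 2) - 2 * Real.log (1 - κ) - 2 * κ) / C) := by
    norm_cast
  rw [hrhs] at keyre
  have hfinal := congrArg (fun x => C / (2 * Real.pi) * x) keyre
  rw [← intervalIntegral.integral_const_mul] at hfinal
  have hpi := Real.pi_pos
  convert hfinal using 1
  · refine intervalIntegral.integral_congr fun θ _ => ?_
    have hreh : (h (Complex.exp (θ * Complex.I))).re =
        Real.log C - 2 * Real.log (1 - 2 * κ * Real.cos θ + κ ^ 2) := by
      have hnorm : ‖1 - κ * Complex.exp (θ * Complex.I)‖ ^ 2 =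
          1 - 2 * κ * Real.cos θ + κ ^ 2 := by
        rw [Complex.sq_norm, Complex.normSq_apply]
        simp only [Complex.sub_re, Complex.sub_im, Complex.re_ofReal_mul, Complex.im_ofReal_mul,
          Complex.exp_ofReal_mul_I_re, Complex.exp_ofReal_mul_I_im, Complex.one_re, Complex.one_im]
        linear_combination κ ^ 2 * Real.sin_sq_add_cos_sq θ
      rw [← hnorm, Real.log_pow]
      simp only [hh, Complex.sub_re, Complex.ofReal_re, Complex.mul_re, Complex.log_re]
      norm_num
      ring
    have hD := hDpos θ
    have hf : (1 - κ ^ 2) ^ 3 / ((1 - κ) * (1 + κ + κ ^ 2 - κ * (1 + 2 * Real.cos θ))) ^ 2 =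
        C / (1 - 2 * κ * Real.cos θ + κ ^ 2) ^ 2 := by
      have e : 1 + κ + κ ^ 2 - κ * (1 + 2 * Real.cos θ) = 1 - 2 * κ * Real.cos θ + κ ^ 2 := by ring
      rw [e, hC]
      field_simp
      ring
    simp only [hf, hreh]
    rw [Real.log_div hCpos.ne' (by positivity), Real.log_pow]
    push_cast
    ring
  · field_simp

end CircleIntegral

section HaarAngle

/-- The angular density of the Haar measure on `SO(3)`, on one full turn. -/
noncomputable def haarAngleMeasure : Measure ℝ :=
  (volume.restrict (Set.Ioc 0 (2 * Real.pi))).withDensity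
    fun θ => ENNReal.ofReal ((1 - Real.cos θ) / (2 * Real.pi))

instance : IsFiniteMeasure haarAngleMeasure := by
  refine isFiniteMeasure_withDensity_ofReal ?_
  have : Continuous fun θ : ℝ => (1 - Real.cos θ) / (2 * Real.pi) := by fun_prop
  exact ((this.intervalIntegrable 0 (2 * Real.pi)).1).2

theorem integral_haarAngleMeasure (φ : ℝ → ℝ) :
    ∫ θ, φ θ ∂haarAngleMeasure =
      ∫ θ in (0 : ℝ)..2 * Real.pi, (1 - Real.cos θ) / (2 * Real.pi) * φ θ := by
  rw [haarAngleMeasure, integral_withDensity_eq_integral_toReal_smul (by fun_prop)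
    (Filter.Eventually.of_forall fun _ => ENNReal.ofReal_lt_top),
    intervalIntegral.integral_of_le (by positivity)]
  refine integral_congr_ae (Filter.Eventually.of_forall fun θ => ?_)
  have : 0 ≤ (1 - Real.cos θ) / (2 * Real.pi) :=
    div_nonneg (by linarith [Real.cos_le_one θ]) (by positivity)
  simp [ENNReal.toReal_ofReal this]

theorem integral_haarAngleMeasure_one : ∫ _, (1 : ℝ) ∂haarAngleMeasure = 1 := by
  rw [integral_haarAngleMeasure]
  simp only [mul_one, intervalIntegral.integral_div]
  rw [intervalIntegral.integral_sub (by simp) (Real.continuous_cos.intervalIntegrable _ _)]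
  simp [Real.pi_ne_zero]

theorem haarAngleMeasure_moment_recursion (n : ℕ) :
    (n + 2 : ℝ) * ∫ θ, (1 + 2 * Real.cos θ) ^ (n + 1) ∂haarAngleMeasure =
      2 * n * ∫ θ, (1 + 2 * Real.cos θ) ^ n ∂haarAngleMeasure +
        3 * n * ∫ θ, (1 + 2 * Real.cos θ) ^ (n - 1) ∂haarAngleMeasure := by
  have hint : ∀ c : ℝ, ∀ k : ℕ, IntervalIntegrable (fun θ : ℝ =>
      c * ((1 - Real.cos θ) / (2 * Real.pi) * (1 + 2 * Real.cos θ) ^ k)) volume 0 (2 * Real.pi) :=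
    fun c k => Continuous.intervalIntegrable (by fun_prop) _ _
  have hderiv : ∀ θ : ℝ, HasDerivAt
      (fun θ => -2 * Real.sin θ * (1 - Real.cos θ) * (1 + 2 * Real.cos θ) ^ n / (2 * Real.pi))
      (2 * n * ((1 - Real.cos θ) / (2 * Real.pi) * (1 + 2 * Real.cos θ) ^ n) +
        3 * n * ((1 - Real.cos θ) / (2 * Real.pi) * (1 + 2 * Real.cos θ) ^ (n - 1)) -
        (n + 2) * ((1 - Real.cos θ) / (2 * Real.pi) * (1 + 2 * Real.cos θ) ^ (n + 1))) θ := by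
    intro θ
    have hc := Real.hasDerivAt_cos θ
    refine (((((Real.hasDerivAt_sin θ).const_mul (-2)).fun_mul (hc.const_sub 1)).fun_mul
      (((hc.const_mul 2).const_add 1).fun_pow n)).div_const (2 * Real.pi)).congr_deriv ?_
    have hs : Real.sin θ ^ 2 = 1 - Real.cos θ ^ 2 := Real.sin_sq θ
    have hpi := Real.pi_ne_zero
    cases n with
    | zero =>
      field_simp
      push_cast
      linear_combination (-2) * hs
    | succ m =>
      simp only [Nat.add_sub_cancel]
      field_simp
      push_cast
      simp only [pow_succ]
      linear_combination
        ((1 + 2 * Real.cos θ) ^ m * (-2 * (1 + 2 * Real.cos θ) +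
          4 * (m + 1) * (1 - Real.cos θ))) * hs
  have hFTC := intervalIntegral.integral_eq_sub_of_hasDerivAt (a := 0) (b := 2 * Real.pi)
    (fun θ _ => hderiv θ) (((hint _ _).add (hint _ _)).sub (hint _ _))
  rw [intervalIntegral.integral_sub ((hint _ _).add (hint _ _)) (hint _ _),
    intervalIntegral.integral_add (hint _ _) (hint _ _)] at hFTC
  simp only [intervalIntegral.integral_const_mul, Real.sin_two_pi, Real.sin_zero, mul_zero,
    zero_mul, zero_div, sub_zero] at hFTC
  simp only [integral_haarAngleMeasure]
  linarith

end HaarAngle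

section Rotations

variable {P : Matrix (Fin 3) (Fin 3) ℝ}

theorem adjugate_eq_transpose_of_rotation (hP : Pᵀ * P = 1) (hdet : P.det = 1) :
    P.adjugate = Pᵀ := by
  have h := congrArg (Pᵀ * ·) (mul_adjugate P)
  simpa [← mul_assoc, hP, hdet] using h

/-- The sum of the principal minors of a rotation is its trace. -/
theorem trace_adjugate_of_rotation (hP : Pᵀ * P = 1) (hdet : P.det = 1) :
    P.adjugate.trace = P.trace := by
  rw [adjugate_eq_transpose_of_rotation hP hdet, trace_transpose]

theorem det_sub_smul_one_of_rotation (hP : Pᵀ * P = 1) (hdet : P.det = 1) (κ : ℝ) :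
    (P - κ • (1 : Matrix (Fin 3) (Fin 3) ℝ)).det =
      (1 - κ) * (1 + κ + κ ^ 2 - κ * P.trace) := by
  have h := trace_adjugate_of_rotation hP hdet
  rw [det_fin_three] at hdet
  simp only [adjugate_fin_three, trace_fin_three, of_apply, cons_val', cons_val_zero,
    cons_val_one, cons_val, cons_val_fin_one] at h
  simp [det_fin_three, trace_fin_three]
  linear_combination hdet - κ * h

/-- The infinitesimal rotation about the `i`-th coordinate axis. -/
def rotationGenerator (i : Fin 3) : Matrix (Fin 3) (Fin 3) ℝ :=
  ![!![0, 0, 0; 0, 0, -1; 0, 1, 0], !![0, 0, 1; 0, 0, 0; -1, 0, 0],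
    !![0, -1, 0; 1, 0, 0; 0, 0, 0]] i

/-- The rotation by the angle `s` about the `i`-th coordinate axis. -/
noncomputable def axisRotation (i : Fin 3) (s : ℝ) : Matrix (Fin 3) (Fin 3) ℝ :=
  ![!![1, 0, 0; 0, Real.cos s, -Real.sin s; 0, Real.sin s, Real.cos s],
    !![Real.cos s, 0, Real.sin s; 0, 1, 0; -Real.sin s, 0, Real.cos s],
    !![Real.cos s, -Real.sin s, 0; Real.sin s, Real.cos s, 0; 0, 0, 1]] i

theorem axisRotation_zero (i : Fin 3) : axisRotation i 0 = 1 := by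
  fin_cases i <;> ext j k <;> fin_cases j <;> fin_cases k <;> simp [axisRotation]

theorem axisRotation_transpose_mul_self (i : Fin 3) (s : ℝ) :
    (axisRotation i s)ᵀ * axisRotation i s = 1 := by
  have h := Real.sin_sq_add_cos_sq s
  fin_cases i <;> ext j k <;> fin_cases j <;> fin_cases k <;>
    simp [axisRotation, mul_apply, Fin.sum_univ_three] <;>
    first | linear_combination h | ring1

theorem det_axisRotation (i : Fin 3) (s : ℝ) : (axisRotation i s).det = 1 := by
  have h := Real.sin_sq_add_cos_sq s
  fin_cases i <;> simp [axisRotation, det_fin_three] <;> linear_combination h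

theorem hasDerivAt_axisRotation_apply (i j k : Fin 3) (s : ℝ) :
    HasDerivAt (fun s => axisRotation i s j k) ((rotationGenerator i * axisRotation i s) j k) s := by
  have hs := Real.hasDerivAt_sin s
  have hc := Real.hasDerivAt_cos s
  have hs' := hs.fun_neg
  fin_cases i <;> fin_cases j <;> fin_cases k <;>
    simp [axisRotation, rotationGenerator, mul_apply, Fin.sum_univ_three] <;>
    first | exact hasDerivAt_const _ _ | assumption

theorem hasDerivAt_trace_mul_axisRotation_mul (A : Matrix (Fin 3) (Fin 3) ℝ) (i : Fin 3) (s : ℝ)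
    (P : Matrix (Fin 3) (Fin 3) ℝ) :
    HasDerivAt (fun s => (A * (axisRotation i s * P)).trace)
      (A * (rotationGenerator i * (axisRotation i s * P))).trace s := by
  have e : ∀ B : Matrix (Fin 3) (Fin 3) ℝ,
      (A * (B * P)).trace = ∑ j, ∑ k, (P * A) k j * B j k := by
    intro B
    rw [trace_mul_comm, mul_assoc, trace_mul_comm B]
    simp only [trace, diag_apply, mul_apply (M := P * A)]
    exact Finset.sum_comm
  simp only [← mul_assoc (rotationGenerator i), e]
  exact HasDerivAt.fun_sum fun j _ => HasDerivAt.fun_sum fun k _ =>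
    (hasDerivAt_axisRotation_apply i j k s).const_mul _

theorem sum_trace_rotationGenerator_mul_self_mul (P : Matrix (Fin 3) (Fin 3) ℝ) :
    ∑ i, (rotationGenerator i * (rotationGenerator i * P)).trace = -2 * P.trace := by
  simp [rotationGenerator, trace_fin_three, mul_apply, Fin.sum_univ_three]
  ring

theorem sum_sq_trace_rotationGenerator_mul (hP : Pᵀ * P = 1) (hdet : P.det = 1) :
    ∑ i, (rotationGenerator i * P).trace ^ 2 = (3 - P.trace) * (1 + P.trace) := by
  have h := trace_adjugate_of_rotation hP hdet
  simp only [adjugate_fin_three, trace_fin_three, of_apply, cons_val', cons_val_zero,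
    cons_val_one, cons_val, cons_val_fin_one] at h
  have h3 := congrArg trace hP
  simp only [trace_fin_three, mul_apply, Fin.sum_univ_three, transpose_apply, one_apply_eq] at h3
  simp [rotationGenerator, trace_fin_three, mul_apply, Fin.sum_univ_three]
  linear_combination h3 + 2 * h

theorem trace_mem_Icc_of_rotation (hP : Pᵀ * P = 1) (hdet : P.det = 1) :
    P.trace ∈ Set.Icc (-1 : ℝ) 3 := by
  have h := sum_sq_trace_rotationGenerator_mul hP hdet
  have h0 : 0 ≤ (3 - P.trace) * (1 + P.trace) := h ▸ Finset.sum_nonneg fun i _ => sq_nonneg _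
  constructor <;> nlinarith

theorem isCompact_rotations :
    IsCompact {P : Matrix (Fin 3) (Fin 3) ℝ | Pᵀ * P = 1 ∧ P.det = 1} := by
  have hbox : IsCompact (Set.univ.pi fun _ : Fin 3 => Set.univ.pi fun _ : Fin 3 =>
      Set.Icc (-1 : ℝ) 1) := isCompact_univ_pi fun _ => isCompact_univ_pi fun _ => isCompact_Icc
  refine IsCompact.of_isClosed_subset hbox ?_ ?_
  · exact (isClosed_eq (by fun_prop) continuous_const).inter
      (isClosed_eq (by fun_prop) continuous_const)
  · rintro P ⟨hP, -⟩ i - j -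
    have hU : P ∈ unitaryGroup (Fin 3) ℝ := by
      rw [mem_unitaryGroup_iff', star_eq_conjTranspose, conjTranspose_eq_transpose_of_trivial, hP]
    exact abs_le.mp (entry_norm_bound_of_unitary hU i j)

end Rotations

section Haar

variable {μ : Measure (Matrix (Fin 3) (Fin 3) ℝ)}

theorem integral_comp_rotation_mul
    (hinv : ∀ h : Matrix (Fin 3) (Fin 3) ℝ, hᵀ * h = 1 → h.det = 1 →
      Measure.map (fun P => h * P) μ = μ) {F : Matrix (Fin 3) (Fin 3) ℝ → ℝ}
    (hF : AEStronglyMeasurable F μ) {R : Matrix (Fin 3) (Fin 3) ℝ} (hR : Rᵀ * R = 1)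
    (hRdet : R.det = 1) : ∫ P, F (R * P) ∂μ = ∫ P, F P ∂μ := by
  have hmeas : Measurable fun P : Matrix (Fin 3) (Fin 3) ℝ => R * P :=
    Continuous.measurable (by fun_prop)
  conv_rhs => rw [← hinv R hR hRdet]
  rw [integral_map hmeas.aemeasurable]
  rwa [hinv R hR hRdet]

variable [IsProbabilityMeasure μ]

/-- A continuous function is integrable with respect to a measure supported on `SO(3)`. -/
theorem Continuous.integrable_of_rotations {F : Matrix (Fin 3) (Fin 3) ℝ → ℝ} (hF : Continuous F)
    (hrot : ∀ᵐ P ∂μ, Pᵀ * P = 1 ∧ P.det = 1) : Integrable F μ := by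
  obtain ⟨C, hC⟩ := isCompact_rotations.exists_bound_of_continuousOn hF.continuousOn
  refine Integrable.of_bound hF.aestronglyMeasurable C ?_
  filter_upwards [hrot] with P hP using hC P hP

/-- The derivative of `P ↦ tr (J P) (tr P) ^ n` along an infinitesimal rotation `J` has
Haar integral zero. -/
theorem integral_rotationGenerator_derivative (hrot : ∀ᵐ P ∂μ, Pᵀ * P = 1 ∧ P.det = 1)
    (hinv : ∀ h : Matrix (Fin 3) (Fin 3) ℝ, hᵀ * h = 1 → h.det = 1 →
      Measure.map (fun P => h * P) μ = μ) (i : Fin 3) (n : ℕ) :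
    ∫ P, ((rotationGenerator i * (rotationGenerator i * P)).trace * P.trace ^ n +
      n * P.trace ^ (n - 1) * (rotationGenerator i * P).trace ^ 2) ∂μ = 0 := by
  set F : Matrix (Fin 3) (Fin 3) ℝ → ℝ := fun P =>
    (rotationGenerator i * P).trace * P.trace ^ n with hF
  set F' : Matrix (Fin 3) (Fin 3) ℝ → ℝ := fun P =>
    (rotationGenerator i * (rotationGenerator i * P)).trace * P.trace ^ n +
      n * P.trace ^ (n - 1) * (rotationGenerator i * P).trace ^ 2 with hF'
  have hFc : Continuous F := by fun_prop
  have hF'c : Continuous F' := by fun_prop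
  obtain ⟨C, hC⟩ := isCompact_rotations.exists_bound_of_continuousOn hF'c.continuousOn
  have hmain := (hasDerivAt_integral_of_dominated_loc_of_deriv_le (μ := μ) (x₀ := (0 : ℝ))
    (F := fun s P => F (axisRotation i s * P)) (F' := fun s P => F' (axisRotation i s * P))
    (bound := fun _ => C) Filter.univ_mem
    (Filter.Eventually.of_forall fun s => Continuous.aestronglyMeasurable (by fun_prop))
    (Continuous.integrable_of_rotations (by fun_prop) hrot)
    (Continuous.aestronglyMeasurable (by fun_prop)) ?_ (integrable_const C) ?_).2
  · have hconst : (fun s => ∫ P, F (axisRotation i s * P) ∂μ) = fun _ => ∫ P, F P ∂μ := by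
      funext s
      exact integral_comp_rotation_mul hinv hFc.aestronglyMeasurable
        (axisRotation_transpose_mul_self i s) (det_axisRotation i s)
    rw [hconst] at hmain
    simpa [axisRotation_zero] using hmain.unique (hasDerivAt_const _ _)
  · filter_upwards [hrot] with P hP s _
    refine hC _ ⟨?_, ?_⟩
    · rw [transpose_mul, mul_assoc, ← mul_assoc _ _ P, axisRotation_transpose_mul_self, one_mul,
        hP.1]
    · rw [det_mul, det_axisRotation, hP.2, one_mul]
  · refine Filter.Eventually.of_forall fun P s _ => ?_
    have h1 := hasDerivAt_trace_mul_axisRotation_mul (rotationGenerator i) i s P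
    have h2 := hasDerivAt_trace_mul_axisRotation_mul 1 i s P
    simp only [one_mul] at h2
    refine (h1.fun_mul (h2.fun_pow n)).congr_deriv ?_
    simp only [hF']
    ring

theorem haar_trace_moment_recursion (hrot : ∀ᵐ P ∂μ, Pᵀ * P = 1 ∧ P.det = 1)
    (hinv : ∀ h : Matrix (Fin 3) (Fin 3) ℝ, hᵀ * h = 1 → h.det = 1 →
      Measure.map (fun P => h * P) μ = μ) (n : ℕ) :
    (n + 2 : ℝ) * ∫ P, P.trace ^ (n + 1) ∂μ =
      2 * n * ∫ P, P.trace ^ n ∂μ + 3 * n * ∫ P, P.trace ^ (n - 1) ∂μ := by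
  have hint : ∀ c : ℝ, ∀ k : ℕ,
      Integrable (fun P : Matrix (Fin 3) (Fin 3) ℝ => c * P.trace ^ k) μ :=
    fun c k => Continuous.integrable_of_rotations (by fun_prop) hrot
  have hsum := Finset.sum_eq_zero fun i (_ : i ∈ Finset.univ) =>
    integral_rotationGenerator_derivative hrot hinv i n
  rw [← integral_finsetSum _ fun i _ => Continuous.integrable_of_rotations (by fun_prop) hrot]
    at hsum
  have hcongr : ∀ᵐ P : Matrix (Fin 3) (Fin 3) ℝ ∂μ,
      ∑ i, ((rotationGenerator i * (rotationGenerator i * P)).trace * P.trace ^ n +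
        (n : ℝ) * P.trace ^ (n - 1) * (rotationGenerator i * P).trace ^ 2) =
      2 * n * P.trace ^ n + 3 * n * P.trace ^ (n - 1) - (n + 2) * P.trace ^ (n + 1) := by
    filter_upwards [hrot] with P hP
    rw [Finset.sum_add_distrib, ← Finset.sum_mul, ← Finset.mul_sum,
      sum_trace_rotationGenerator_mul_self_mul, sum_sq_trace_rotationGenerator_mul hP.1 hP.2]
    cases n with
    | zero => simp
    | succ m =>
      simp only [Nat.add_sub_cancel]
      push_cast
      ring
  rw [integral_congr_ae hcongr,
    integral_sub (Continuous.integrable_of_rotations (by fun_prop) hrot) (hint _ _),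
    integral_add (hint _ _) (hint _ _)] at hsum
  simp only [integral_const_mul] at hsum
  linarith

/-- **Weyl's integration formula** for continuous class functions on `SO(3)`. -/
theorem integral_comp_trace_eq (hrot : ∀ᵐ P ∂μ, Pᵀ * P = 1 ∧ P.det = 1)
    (hinv : ∀ h : Matrix (Fin 3) (Fin 3) ℝ, hᵀ * h = 1 → h.det = 1 →
      Measure.map (fun P => h * P) μ = μ) {g : ℝ → ℝ} (hg : ContinuousOn g (Set.Icc (-1) 3)) :
    ∫ P, g P.trace ∂μ =
      ∫ θ in (0 : ℝ)..2 * Real.pi, (1 - Real.cos θ) / (2 * Real.pi) * g (1 + 2 * Real.cos θ) := by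
  rw [← integral_haarAngleMeasure fun θ => g (1 + 2 * Real.cos θ)]
  refine integral_comp_eq_of_moments_eq (Continuous.aestronglyMeasurable (by fun_prop))
    (Continuous.aestronglyMeasurable (by fun_prop)) ?_
    (Filter.Eventually.of_forall fun θ => ?_) ?_ hg
  · filter_upwards [hrot] with P hP using trace_mem_Icc_of_rotation hP.1 hP.2
  · constructor <;> linarith [Real.neg_one_le_cos θ, Real.cos_le_one θ]
  · refine eq_of_trace_moment_recursion ?_ (haar_trace_moment_recursion hrot hinv)
      haarAngleMeasure_moment_recursion
    simpa using integral_haarAngleMeasure_one.symm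

end Haar

/-- Fix `M ∈ SO(3)` and `κ ∈ [0, 1)`, and let `μ` be the Haar probability measure on
`SO(3)` (encoded as a Borel probability measure on `3 × 3` matrices supported on `SO(3)`
and invariant under left translation by `SO(3)`). With
`f(P) = (1 - κ²)³ det (P Mᵀ - κ I₃)⁻²` the density of the Cayley distribution
`𝒞₃(M, κ)`, the Kullback–Leibler divergence of `𝒞₃(M, κ)` from the uniform distribution
is `∫ f log f dμ = -log (1 - κ²) - 2 log (1 - κ) - 2κ`. -/
theorem kl_cayley_SO3 (M : Matrix (Fin 3) (Fin 3) ℝ)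
    (hM : Mᵀ * M = 1) (hMdet : M.det = 1)
    (κ : ℝ) (hκ0 : 0 ≤ κ) (hκ1 : κ < 1)
    (μ : Measure (Matrix (Fin 3) (Fin 3) ℝ)) [IsProbabilityMeasure μ]
    (hsupp : μ {P | ¬(Pᵀ * P = 1 ∧ P.det = 1)} = 0)
    (hinv : ∀ h : Matrix (Fin 3) (Fin 3) ℝ, hᵀ * h = 1 → h.det = 1 →
      Measure.map (fun P => h * P) μ = μ)
    (f : Matrix (Fin 3) (Fin 3) ℝ → ℝ)
    (hf : ∀ P, f P =
      (1 - κ ^ 2) ^ 3 / (P * Mᵀ - κ • (1 : Matrix (Fin 3) (Fin 3) ℝ)).det ^ 2) :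
    ∫ P, f P * Real.log (f P) ∂μ =
      -Real.log (1 - κ ^ 2) - 2 * Real.log (1 - κ) - 2 * κ := by
  have hrot : ∀ᵐ P ∂μ, Pᵀ * P = 1 ∧ P.det = 1 := hsupp
  have hMM : M * Mᵀ = 1 := mul_eq_one_comm.mp hM
  set g : ℝ → ℝ := fun t => (1 - κ ^ 2) ^ 3 / ((1 - κ) * (1 + κ + κ ^ 2 - κ * t)) ^ 2 *
    Real.log ((1 - κ ^ 2) ^ 3 / ((1 - κ) * (1 + κ + κ ^ 2 - κ * t)) ^ 2) with hg
  have hgc : ContinuousOn g (Set.Icc (-1) 3) := by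
    have hsq : 0 < 1 - κ ^ 2 := by nlinarith
    have hden : ∀ t ∈ Set.Icc (-1 : ℝ) 3, ((1 - κ) * (1 + κ + κ ^ 2 - κ * t)) ^ 2 ≠ 0 := by
      intro t ht
      have h1 : 0 < 1 - κ := by linarith
      have h2 : 0 < 1 + κ + κ ^ 2 - κ * t := by nlinarith [ht.2, mul_pos h1 h1]
      positivity
    have hquot : ContinuousOn
        (fun t => (1 - κ ^ 2) ^ 3 / ((1 - κ) * (1 + κ + κ ^ 2 - κ * t)) ^ 2) (Set.Icc (-1) 3) :=
      ContinuousOn.div (by fun_prop) (by fun_prop) hden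
    exact hquot.mul (hquot.log fun t ht => div_ne_zero (by positivity) (hden t ht))
  have htr : Continuous fun P : Matrix (Fin 3) (Fin 3) ℝ => P.trace := by fun_prop
  have hgm : AEStronglyMeasurable (fun P : Matrix (Fin 3) (Fin 3) ℝ => g P.trace) μ := by
    refine (hgc.integrable_comp_of_ae_mem_Icc htr.aestronglyMeasurable ?_).aestronglyMeasurable
    filter_upwards [hrot] with P hP using trace_mem_Icc_of_rotation hP.1 hP.2
  have hfg : ∀ᵐ P ∂μ, f P * Real.log (f P) = g (Mᵀ * P).trace := by
    filter_upwards [hrot] with P hP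
    have hdet : (P * Mᵀ - κ • (1 : Matrix (Fin 3) (Fin 3) ℝ)).det =
        (1 - κ) * (1 + κ + κ ^ 2 - κ * (Mᵀ * P).trace) := by
      rw [det_sub_smul_one_of_rotation _ _, trace_mul_comm]
      · rw [transpose_mul, transpose_transpose, mul_assoc, ← mul_assoc _ P, hP.1, one_mul, hMM]
      · rw [det_mul, det_transpose, hP.2, hMdet, one_mul]
    rw [hf, hdet]
  rw [integral_congr_ae hfg,
    integral_comp_rotation_mul hinv hgm (R := Mᵀ) (by rwa [transpose_transpose])
      (by rw [det_transpose, hMdet]), integral_comp_trace_eq hrot hinv hgc]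
  exact integral_one_sub_cos_mul_cayley hκ0 hκ1
end
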